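/- arXiv:2008.01290 — 5 statements merged into one kernel-verified Lean document; each statement's English description precedes it below -/
import Mathlib

section
/- Let T > 0, 0 ≤ θ < 1 and A, M ≥ 0, and let ψ : [0,T] → [0,∞) be a continuous function satisfying ψ(t) ≤ A + M ∫_0^t (t−τ)^{−θ} ψ(τ) dτ for all t ∈ [0,T]. Then ψ(t) ≤ A · E_{1−θ}(M Γ(1−θ) t^{1−θ}) for all t ∈ [0,T], where E_ρ is the Mittag-Leffler function. -/
open MeasureTheory Real Set

/-- The Mittag-Leffler function `E_ρ(z) = Σ_{n=0}^∞ z^n / Γ(nρ + 1)`. -/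
noncomputable def mittagLeffler (ρ z : ℝ) : ℝ :=
  ∑' n : ℕ, z ^ n / Real.Gamma (n * ρ + 1)

/-- Log-convexity of `Γ` gives the growth bound `Γ (x + ρ) ≥ (x - 1) ^ ρ Γ x`. -/
theorem rpow_mul_Gamma_le_Gamma_add {x ρ : ℝ} (hx : 1 < x) (hρ : 0 < ρ) :
    (x - 1) ^ ρ * Real.Gamma x ≤ Real.Gamma (x + ρ) := by
  have hx1 : 0 < x - 1 := by linarith
  have hΓ : 0 < Real.Gamma (x - 1) := Real.Gamma_pos_of_pos hx1
  have hΓx : 0 < Real.Gamma x := Real.Gamma_pos_of_pos (by linarith)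
  have hΓρ : 0 < Real.Gamma (x + ρ) := Real.Gamma_pos_of_pos (by linarith)
  have h := Real.convexOn_log_Gamma.slope_mono_adjacent (x := x - 1) (y := x) (z := x + ρ)
    (Set.mem_Ioi.2 hx1) (Set.mem_Ioi.2 (by linarith)) (by linarith) (by linarith)
  have hrec : Real.Gamma x = (x - 1) * Real.Gamma (x - 1) := by
    simpa using Real.Gamma_add_one hx1.ne'
  have hlog : Real.log (Real.Gamma x) = Real.log (x - 1) + Real.log (Real.Gamma (x - 1)) := by
    rw [hrec, Real.log_mul hx1.ne' hΓ.ne']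
  simp only [Function.comp_apply, sub_sub_cancel, div_one, add_sub_cancel_left] at h
  rw [le_div_iff₀ hρ] at h
  rw [← Real.log_le_log_iff (by positivity) hΓρ,
    Real.log_mul (Real.rpow_pos_of_pos hx1 ρ).ne' hΓx.ne', Real.log_rpow hx1]
  nlinarith

open Filter Topology in
theorem summable_mittagLeffler {ρ : ℝ} (hρ : 0 < ρ) (z : ℝ) :
    Summable fun n : ℕ => z ^ n / Real.Gamma (n * ρ + 1) := by
  have hlim : Tendsto (fun n : ℕ => ((n : ℝ) * ρ) ^ ρ) atTop atTop :=
    (tendsto_rpow_atTop hρ).comp (tendsto_natCast_atTop_atTop.atTop_mul_const hρ)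
  refine summable_of_ratio_norm_eventually_le (r := 1 / 2) (by norm_num) ?_
  filter_upwards [hlim.eventually_ge_atTop (2 * |z|), eventually_gt_atTop 0] with n hn hn0
  have hnρ : 0 < (n : ℝ) * ρ := by positivity
  have hΓ : 0 < Real.Gamma (n * ρ + 1) := Real.Gamma_pos_of_pos (by linarith)
  have hΓ' : 0 < Real.Gamma ((n + 1 : ℕ) * ρ + 1) := Real.Gamma_pos_of_pos (by positivity)
  have h := rpow_mul_Gamma_le_Gamma_add (x := n * ρ + 1) (by linarith) hρ
  rw [add_sub_cancel_right, show (n : ℝ) * ρ + 1 + ρ = (n + 1 : ℕ) * ρ + 1 by push_cast; ring] at h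
  have h2 : 2 * |z| * Real.Gamma (n * ρ + 1) ≤ Real.Gamma ((n + 1 : ℕ) * ρ + 1) :=
    (mul_le_mul_of_nonneg_right hn hΓ.le).trans h
  rw [norm_div, norm_div, norm_pow, norm_pow, Real.norm_of_nonneg hΓ.le,
    Real.norm_of_nonneg hΓ'.le, Real.norm_eq_abs, ← mul_div_assoc, div_le_div_iff₀ hΓ' hΓ, pow_succ]
  nlinarith [mul_le_mul_of_nonneg_left h2 (pow_nonneg (abs_nonneg z) n)]

theorem integral_rpow_mul_sub_rpow {s t a : ℝ} (hs : 0 < s) (ht : 0 < t) (ha : 0 < a) :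
    ∫ x in (0 : ℝ)..a, x ^ (s - 1) * (a - x) ^ (t - 1) =
      a ^ (s + t - 1) * (Real.Gamma s * Real.Gamma t / Real.Gamma (s + t)) := by
  have h := Complex.betaIntegral_scaled s t ha
  rw [Complex.betaIntegral_eq_Gamma_mul_div _ _ (by simpa) (by simpa)] at h
  apply Complex.ofReal_injective
  rw [← intervalIntegral.integral_ofReal]
  push_cast
  rw [Complex.ofReal_cpow ha.le, ← Complex.Gamma_ofReal, ← Complex.Gamma_ofReal,
    ← Complex.Gamma_ofReal]
  push_cast
  rw [← h]
  refine intervalIntegral.integral_congr fun x hx => ?_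
  rw [Set.uIcc_of_le ha.le] at hx
  rw [Complex.ofReal_cpow hx.1, Complex.ofReal_cpow (sub_nonneg.2 hx.2)]
  push_cast
  rfl

theorem intervalIntegrable_sub_rpow_mul {θ t : ℝ} (hθ : θ < 1) {f : ℝ → ℝ} (ht : 0 ≤ t)
    (hf : ContinuousOn f (Set.Icc 0 t)) :
    IntervalIntegrable (fun τ => (t - τ) ^ (-θ) * f τ) volume 0 t := by
  have h := ((intervalIntegral.intervalIntegrable_rpow' (a := 0) (b := t) (r := -θ)
    (by linarith)).comp_sub_left t).symm
  simp only [sub_self, sub_zero] at h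
  exact h.mul_continuousOn (by rwa [Set.uIcc_of_le ht])

/-- The Abel operator `f ↦ M ∫₀ᵗ (t - τ)^(-θ) f τ dτ` maps each term of the series of
`E_{1-θ}(M Γ(1-θ) t^{1-θ})` to the next one. -/
theorem integral_sub_rpow_mul_mittagLeffler_term {θ : ℝ} (hθ : θ < 1) (M : ℝ) (k : ℕ) {t : ℝ}
    (ht : 0 ≤ t) :
    M * ∫ τ in (0 : ℝ)..t, (t - τ) ^ (-θ) *
        ((M * Real.Gamma (1 - θ) * τ ^ (1 - θ)) ^ k / Real.Gamma (k * (1 - θ) + 1)) =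
      (M * Real.Gamma (1 - θ) * t ^ (1 - θ)) ^ (k + 1) /
        Real.Gamma ((k + 1 : ℕ) * (1 - θ) + 1) := by
  have hρ : 0 < 1 - θ := by linarith
  rcases ht.eq_or_lt with rfl | ht
  · simp [Real.zero_rpow hρ.ne']
  have hs : 0 < (k : ℝ) * (1 - θ) + 1 := by positivity
  have hΓ := (Real.Gamma_pos_of_pos hs).ne'
  have hcongr : ∫ τ in (0 : ℝ)..t, (t - τ) ^ (-θ) *
        ((M * Real.Gamma (1 - θ) * τ ^ (1 - θ)) ^ k / Real.Gamma (k * (1 - θ) + 1)) =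
      ∫ τ in (0 : ℝ)..t, (M * Real.Gamma (1 - θ)) ^ k / Real.Gamma (k * (1 - θ) + 1) *
        (τ ^ (k * (1 - θ) + 1 - 1) * (t - τ) ^ (1 - θ - 1)) := by
    refine intervalIntegral.integral_congr fun τ hτ => ?_
    rw [Set.uIcc_of_le ht.le] at hτ
    rw [mul_pow, ← Real.rpow_mul_natCast hτ.1, add_sub_cancel_right, mul_comm (k : ℝ),
      show 1 - θ - 1 = -θ by ring]
    ring
  rw [hcongr, intervalIntegral.integral_const_mul, integral_rpow_mul_sub_rpow hs hρ ht,
    mul_pow _ _ (k + 1), ← Real.rpow_mul_natCast ht.le,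
    show (k : ℝ) * (1 - θ) + 1 + (1 - θ) = (k + 1 : ℕ) * (1 - θ) + 1 by push_cast; ring,
    add_sub_cancel_right, mul_comm (1 - θ) ((k + 1 : ℕ) : ℝ), mul_pow, mul_pow, pow_succ, pow_succ]
  field_simp

theorem continuous_mittagLeffler_term {ρ : ℝ} (hρ : 0 < ρ) (c : ℝ) (k : ℕ) :
    Continuous fun τ : ℝ => (c * τ ^ ρ) ^ k / Real.Gamma (k * ρ + 1) :=
  ((continuous_const.mul (Real.continuous_rpow_const hρ.le)).pow k).div_const _

/-- The `n`-fold iteration of the singular Gronwall inequality, with remainder. -/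
theorem le_sum_mittagLeffler_terms {T θ A M B : ℝ} (hθ : θ < 1) (hM : 0 ≤ M) {ψ : ℝ → ℝ}
    (hcont : ContinuousOn ψ (Set.Icc 0 T))
    (hineq : ∀ t ∈ Set.Icc (0 : ℝ) T,
      ψ t ≤ A + M * ∫ τ in (0 : ℝ)..t, (t - τ) ^ (-θ) * ψ τ)
    (hB : ∀ t ∈ Set.Icc (0 : ℝ) T, ψ t ≤ B) (n : ℕ) :
    ∀ t ∈ Set.Icc (0 : ℝ) T,
      ψ t ≤ A * ∑ k ∈ Finset.range n,
          (M * Real.Gamma (1 - θ) * t ^ (1 - θ)) ^ k / Real.Gamma (k * (1 - θ) + 1) +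
        B * ((M * Real.Gamma (1 - θ) * t ^ (1 - θ)) ^ n / Real.Gamma (n * (1 - θ) + 1)) := by
  have hρ : 0 < 1 - θ := by linarith
  induction n with
  | zero => simpa using hB
  | succ n ih =>
    intro t ht
    set g : ℕ → ℝ → ℝ := fun k τ =>
      (M * Real.Gamma (1 - θ) * τ ^ (1 - θ)) ^ k / Real.Gamma (k * (1 - θ) + 1) with hg
    have hgc (k : ℕ) : Continuous (g k) := continuous_mittagLeffler_term hρ _ k
    have hgi (k : ℕ) : IntervalIntegrable (fun τ => (t - τ) ^ (-θ) * g k τ) volume 0 t :=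
      intervalIntegrable_sub_rpow_mul hθ ht.1 (hgc k).continuousOn
    have hgn (k : ℕ) : M * ∫ τ in (0 : ℝ)..t, (t - τ) ^ (-θ) * g k τ = g (k + 1) t :=
      integral_sub_rpow_mul_mittagLeffler_term hθ M k ht.1
    have hmono : ∫ τ in (0 : ℝ)..t, (t - τ) ^ (-θ) * ψ τ ≤
        ∫ τ in (0 : ℝ)..t, (t - τ) ^ (-θ) * (A * ∑ k ∈ Finset.range n, g k τ + B * g n τ) := by
      refine intervalIntegral.integral_mono_on ht.1
        (intervalIntegrable_sub_rpow_mul hθ ht.1 (hcont.mono (Set.Icc_subset_Icc_right ht.2)))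
        (intervalIntegrable_sub_rpow_mul hθ ht.1 (by fun_prop)) fun τ hτ => ?_
      exact mul_le_mul_of_nonneg_left (ih τ ⟨hτ.1, hτ.2.trans ht.2⟩)
        (Real.rpow_nonneg (sub_nonneg.2 hτ.2) _)
    have hint : ∫ τ in (0 : ℝ)..t,
          (t - τ) ^ (-θ) * (A * ∑ k ∈ Finset.range n, g k τ + B * g n τ) =
        A * ∑ k ∈ Finset.range n, (∫ τ in (0 : ℝ)..t, (t - τ) ^ (-θ) * g k τ) +
          B * ∫ τ in (0 : ℝ)..t, (t - τ) ^ (-θ) * g n τ := by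
      rw [← intervalIntegral.integral_finsetSum fun k _ => hgi k,
        ← intervalIntegral.integral_const_mul, ← intervalIntegral.integral_const_mul,
        ← intervalIntegral.integral_add]
      · refine intervalIntegral.integral_congr fun τ _ => ?_
        simp only [← Finset.mul_sum]
        ring
      · simp only [← Finset.mul_sum]
        exact (intervalIntegrable_sub_rpow_mul hθ ht.1 (by fun_prop)).const_mul A
      · exact (hgi n).const_mul B
    have hg0 : g 0 t = 1 := by simp [hg]
    calc ψ t ≤ A + M * ∫ τ in (0 : ℝ)..t, (t - τ) ^ (-θ) * ψ τ := hineq t ht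
      _ ≤ A + M * ∫ τ in (0 : ℝ)..t,
          (t - τ) ^ (-θ) * (A * ∑ k ∈ Finset.range n, g k τ + B * g n τ) := by gcongr
      _ = A * ∑ k ∈ Finset.range (n + 1), g k t + B * g (n + 1) t := by
        rw [hint, Finset.sum_range_succ', hg0, ← hgn n, ← Finset.sum_congr rfl fun k _ => hgn k,
          ← Finset.mul_sum]
        ring

/-- Singular Gronwall inequality: if `ψ : [0,T] → [0,∞)` is continuous and
`ψ(t) ≤ A + M ∫_0^t (t-τ)^{-θ} ψ(τ) dτ` with `0 ≤ θ < 1`, `A, M ≥ 0`, then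
`ψ(t) ≤ A E_{1-θ}(M Γ(1-θ) t^{1-θ})` on `[0,T]`. -/
theorem stmt_2 (T θ A M : ℝ) (hT : 0 < T) (hθ0 : 0 ≤ θ) (hθ1 : θ < 1)
    (hA : 0 ≤ A) (hM : 0 ≤ M) (ψ : ℝ → ℝ)
    (hcont : ContinuousOn ψ (Set.Icc 0 T))
    (hnonneg : ∀ t ∈ Set.Icc (0 : ℝ) T, 0 ≤ ψ t)
    (hineq : ∀ t ∈ Set.Icc (0 : ℝ) T,
      ψ t ≤ A + M * ∫ τ in (0 : ℝ)..t, (t - τ) ^ (-θ) * ψ τ) :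
    ∀ t ∈ Set.Icc (0 : ℝ) T,
      ψ t ≤ A * mittagLeffler (1 - θ) (M * Real.Gamma (1 - θ) * t ^ (1 - θ)) := by
  intro t ht
  have hρ : 0 < 1 - θ := by linarith
  obtain ⟨B, hB⟩ := isCompact_Icc.bddAbove_image hcont
  have hle (n : ℕ) := le_sum_mittagLeffler_terms hθ1 hM hcont hineq
    (fun t ht => hB (Set.mem_image_of_mem ψ ht)) n t ht
  have hsum := summable_mittagLeffler hρ (M * Real.Gamma (1 - θ) * t ^ (1 - θ))
  have hlim := (hsum.hasSum.tendsto_sum_nat.const_mul A).add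
    (hsum.tendsto_atTop_zero.const_mul B)
  rw [mul_zero, add_zero] at hlim
  exact ge_of_tendsto' hlim hle
end

section
/- Let N ≥ 3, −2 < α ≤ 0, let σ > −1, m ∈ ℝ, and let w : ℝ^N → ℝ be bounded and continuous. Let T > 0 and let u₀ : ℝ^N → ℝ be bounded and continuous. If u and v are both bounded continuous mild solutions on [0,T] of u_t − Δu = |x|^α |u|^p + ζ(t) w(x) with initial data u₀ (with p > 1), then u(t,x) = v(t,x) for all (t,x) ∈ [0,T] × ℝ^N. -/
open MeasureTheory Real Set

/-- The heat kernel `G_t(x) = (4πt)^{-N/2} exp(-|x|²/(4t))` on `ℝ^N`. -/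
noncomputable def heatKernel (N : ℕ) (t : ℝ) (x : EuclideanSpace ℝ (Fin N)) : ℝ :=
  (4 * Real.pi * t) ^ (-(N : ℝ) / 2) * Real.exp (-‖x‖ ^ 2 / (4 * t))

/-- The forcing profile `ζ(t) = t^σ` for `0 < t < 1` and `ζ(t) = t^m` for `t ≥ 1`. -/
noncomputable def zeta (σ m t : ℝ) : ℝ := if t < 1 then t ^ σ else t ^ m

/-- `u` is a bounded continuous mild solution on `[0,T]` of
`u_t - Δu = |x|^α |u|^p + ζ(t) w(x)` with initial data `u₀`:
`u` is bounded and continuous on `[0,T] × ℝ^N`, `u(0,·) = u₀`, and for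
`0 < t ≤ T` it satisfies the Duhamel formula. -/
def IsMildSolution (N : ℕ) (α p σ m T : ℝ)
    (w u₀ : EuclideanSpace ℝ (Fin N) → ℝ)
    (u : ℝ → EuclideanSpace ℝ (Fin N) → ℝ) : Prop :=
  ContinuousOn (fun q : ℝ × EuclideanSpace ℝ (Fin N) => u q.1 q.2)
      (Set.Icc 0 T ×ˢ Set.univ) ∧
  (∃ B : ℝ, ∀ t ∈ Set.Icc (0 : ℝ) T, ∀ x, |u t x| ≤ B) ∧
  (∀ x, u 0 x = u₀ x) ∧
  ∀ t ∈ Set.Ioc (0 : ℝ) T, ∀ x,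
    u t x = (∫ y, heatKernel N t (x - y) * u₀ y)
      + (∫ τ in (0 : ℝ)..t, ∫ y, heatKernel N (t - τ) (x - y) * ‖y‖ ^ α * |u τ y| ^ p)
      + ∫ τ in (0 : ℝ)..t, zeta σ m τ * ∫ y, heatKernel N (t - τ) (x - y) * w y

lemma heatKernel_nonneg (N : ℕ) {s : ℝ} (hs : 0 ≤ s) (x : EuclideanSpace ℝ (Fin N)) :
    0 ≤ heatKernel N s x := by
  unfold heatKernel
  positivity

lemma heatKernel_zero_time {N : ℕ} (hN : 0 < N) (x : EuclideanSpace ℝ (Fin N)) :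
    heatKernel N 0 x = 0 := by
  have : -(N : ℝ) / 2 ≠ 0 := by
    have : (0 : ℝ) < N := by exact_mod_cast hN
    linarith
  simp [heatKernel, Real.zero_rpow this]

lemma heatKernel_le (N : ℕ) {s : ℝ} (hs : 0 ≤ s) (x : EuclideanSpace ℝ (Fin N)) :
    heatKernel N s x ≤ (4 * π * s) ^ (-(N : ℝ) / 2) := by
  unfold heatKernel
  refine mul_le_of_le_one_right (by positivity) (Real.exp_le_one_iff.2 ?_)
  rw [neg_div, neg_nonpos]
  positivity

lemma integral_heatKernel (N : ℕ) {s : ℝ} (hs : 0 < s) :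
    ∫ x, heatKernel N s x = 1 := by
  have h := GaussianFourier.integral_rexp_neg_mul_sq_norm
    (V := EuclideanSpace ℝ (Fin N)) (b := 1 / (4 * s)) (by positivity)
  have h2 : π / (1 / (4 * s)) = 4 * π * s := by field_simp
  unfold heatKernel
  rw [integral_const_mul]
  have h3 : ∀ x : EuclideanSpace ℝ (Fin N),
      -‖x‖ ^ 2 / (4 * s) = -(1 / (4 * s)) * ‖x‖ ^ 2 := fun x => by ring
  simp_rw [h3]
  rw [h, h2, finrank_euclideanSpace_fin, ← Real.rpow_add (by positivity)]
  rw [show -(N : ℝ) / 2 + N / 2 = 0 by ring, Real.rpow_zero]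

lemma measurable_heatKernel (N : ℕ) :
    Measurable fun q : ℝ × EuclideanSpace ℝ (Fin N) => heatKernel N q.1 q.2 := by
  unfold heatKernel
  fun_prop

/-- The power `‖y‖ ^ α`, truncated to the ball of radius `r`, is integrable when `α > -N`,
with integral proportional to `r ^ (N + α)`. -/
lemma integral_truncated_norm_rpow {N : ℕ} (hN : 0 < N) {α : ℝ} (hα : -(N : ℝ) < α)
    {r : ℝ} (hr : 0 ≤ r) :
    Integrable (fun y : EuclideanSpace ℝ (Fin N) => (Iic r).indicator (fun a => a ^ α) ‖y‖) ∧
    ∫ y : EuclideanSpace ℝ (Fin N), (Iic r).indicator (fun a => a ^ α) ‖y‖ =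
      N * volume.real (Metric.ball (0 : EuclideanSpace ℝ (Fin N)) 1) *
        (r ^ (N + α) / (N + α)) := by
  have : Nonempty (Fin N) := ⟨⟨0, hN⟩⟩
  have hN1 : ((N - 1 : ℕ) : ℝ) = N - 1 := by
    rw [Nat.cast_sub hN]; simp
  have key : EqOn (fun y : ℝ => y ^ (N - 1) • (Iic r).indicator (fun a => a ^ α) y)
      ((Iic r).indicator fun y : ℝ => y ^ ((N : ℝ) - 1 + α)) (Ioi 0) := by
    intro y hy
    by_cases h : y ∈ Iic r
    · simp only [indicator_of_mem h, smul_eq_mul]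
      rw [Real.rpow_add hy, ← hN1, Real.rpow_natCast]
    · simp [indicator_of_notMem h]
  have hexp : -1 < (N : ℝ) - 1 + α := by linarith
  constructor
  · rw [integrable_fun_norm_addHaar, finrank_euclideanSpace_fin]
    refine IntegrableOn.congr_fun ?_ key.symm measurableSet_Ioi
    rw [IntegrableOn, integrable_indicator_iff measurableSet_Iic, IntegrableOn,
      Measure.restrict_restrict measurableSet_Iic, inter_comm, Ioi_inter_Iic]
    exact (intervalIntegrable_iff_integrableOn_Ioc_of_le hr).1
      (intervalIntegral.intervalIntegrable_rpow' hexp)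
  · rw [integral_fun_norm_addHaar, finrank_euclideanSpace_fin,
      setIntegral_congr_fun measurableSet_Ioi key, setIntegral_indicator measurableSet_Iic,
      Ioi_inter_Iic, ← intervalIntegral.integral_of_le hr, integral_rpow (Or.inl hexp),
      show (N : ℝ) - 1 + α + 1 = N + α by ring, Real.zero_rpow (by linarith)]
    simp [mul_assoc]

/-- Smoothing estimate for the heat semigroup acting on a singular power:
`∫ G_s(x - y) |y|^α dy ≤ C s^(α/2)`. -/
lemma exists_integral_heatKernel_mul_norm_rpow_le {N : ℕ} (hN : 0 < N) {α : ℝ}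
    (hα : -(N : ℝ) < α) (hα0 : α ≤ 0) :
    ∃ C : ℝ, 0 ≤ C ∧ ∀ s : ℝ, 0 ≤ s → ∀ x : EuclideanSpace ℝ (Fin N),
      Integrable (fun y => heatKernel N s (x - y) * ‖y‖ ^ α) ∧
      ∫ y, heatKernel N s (x - y) * ‖y‖ ^ α ≤ C * s ^ (α / 2) := by
  have hNα : 0 < N + α := by linarith
  set V := N * volume.real (Metric.ball (0 : EuclideanSpace ℝ (Fin N)) 1) with hV
  have hV0 : 0 ≤ V := by positivity
  refine ⟨1 + (4 * π) ^ (-(N : ℝ) / 2) * (V / (N + α)), by positivity, fun s hs x => ?_⟩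
  rcases hs.eq_or_lt with rfl | hs
  · simp only [heatKernel_zero_time hN, zero_mul, integral_zero]
    exact ⟨integrable_zero _ _ _, by positivity⟩
  obtain ⟨hI, hE⟩ := integral_truncated_norm_rpow hN hα (Real.sqrt_nonneg s)
  have hG : Integrable (fun y => heatKernel N s (x - y)) :=
    (integrable_of_integral_eq_one (integral_heatKernel N hs)).comp_sub_left x
  have hG1 : ∫ y, heatKernel N s (x - y) = 1 := by
    rw [integral_sub_left_eq_self (heatKernel N s) volume x, integral_heatKernel N hs]
  have hbd : Integrable (fun y => s ^ (α / 2) * heatKernel N s (x - y) +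
      (4 * π * s) ^ (-(N : ℝ) / 2) * (Iic (√s)).indicator (fun a => a ^ α) ‖y‖) :=
    (hG.const_mul _).add (hI.const_mul _)
  have hle : ∀ y, heatKernel N s (x - y) * ‖y‖ ^ α ≤ s ^ (α / 2) * heatKernel N s (x - y) +
      (4 * π * s) ^ (-(N : ℝ) / 2) * (Iic (√s)).indicator (fun a => a ^ α) ‖y‖ := by
    intro y
    have h0 := heatKernel_nonneg N hs.le (x - y)
    by_cases h : ‖y‖ ∈ Iic (√s)
    · rw [indicator_of_mem h]
      have := mul_le_mul_of_nonneg_right (heatKernel_le N hs.le (x - y))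
        (Real.rpow_nonneg (norm_nonneg y) α)
      have : 0 ≤ s ^ (α / 2) * heatKernel N s (x - y) := by positivity
      linarith
    · rw [indicator_of_notMem h, mul_zero, add_zero, mul_comm]
      refine mul_le_mul_of_nonneg_right ?_ h0
      have h1 : √s ≤ ‖y‖ := (not_le.1 h).le
      have h2 := Real.rpow_le_rpow_of_nonpos (Real.sqrt_pos.2 hs) h1 hα0
      rwa [Real.sqrt_eq_rpow, ← Real.rpow_mul hs.le, one_div_mul_eq_div] at h2
  have hint : Integrable (fun y => heatKernel N s (x - y) * ‖y‖ ^ α) := by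
    refine hbd.mono' ?_ (Filter.Eventually.of_forall fun y => ?_)
    · have h1 : Measurable fun y => heatKernel N s (x - y) :=
        (measurable_heatKernel N).comp (measurable_const.prodMk (measurable_const.sub measurable_id))
      exact (h1.mul (by fun_prop)).aestronglyMeasurable
    · rw [Real.norm_of_nonneg
        (mul_nonneg (heatKernel_nonneg N hs.le _) (Real.rpow_nonneg (norm_nonneg y) α))]
      exact hle y
  refine ⟨hint, (integral_mono hint hbd hle).trans_eq ?_⟩
  rw [integral_add (hG.const_mul _) (hI.const_mul _), integral_const_mul, integral_const_mul,
    hG1, hE, ← hV, Real.sqrt_eq_rpow, ← Real.rpow_mul hs.le,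
    Real.mul_rpow (by positivity) hs.le]
  have : s ^ (α / 2) = s ^ (-(N : ℝ) / 2) * s ^ (1 / 2 * (N + α)) := by
    rw [← Real.rpow_add hs]; ring_nf
  rw [this]
  ring

lemma abs_abs_rpow_sub_abs_rpow_le {p M a b : ℝ} (hp : 1 ≤ p) (ha : |a| ≤ M) (hb : |b| ≤ M) :
    |(|a| ^ p - |b| ^ p)| ≤ p * M ^ (p - 1) * |a - b| := by
  have h := Convex.norm_image_sub_le_of_norm_hasDerivWithin_le (𝕜 := ℝ) (s := Icc 0 M)
    (f := fun x => x ^ p) (f' := fun x => p * x ^ (p - 1)) (C := p * M ^ (p - 1))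
    (x := |b|) (y := |a|)
    (fun x _ => (Real.hasDerivAt_rpow_const (Or.inr hp)).hasDerivWithinAt)
    (fun x hx => by
      rw [Real.norm_of_nonneg (mul_nonneg (by linarith) (Real.rpow_nonneg hx.1 _))]
      exact mul_le_mul_of_nonneg_left (Real.rpow_le_rpow hx.1 hx.2 (by linarith)) (by linarith))
    (convex_Icc 0 M) ⟨abs_nonneg b, hb⟩ ⟨abs_nonneg a, ha⟩
  have hM : 0 ≤ M := (abs_nonneg a).trans ha
  exact h.trans (mul_le_mul_of_nonneg_left (abs_abs_sub_abs_le a b) (by positivity))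

lemma intervalIntegrable_exp_mul_sub_rpow {a : ℝ} (ha : 0 < a) (l t : ℝ) :
    IntervalIntegrable (fun τ => Real.exp (l * τ) * (t - τ) ^ (a - 1)) volume 0 t := by
  have h := (intervalIntegral.intervalIntegrable_rpow' (a := t) (b := 0) (r := a - 1)
    (by linarith)).comp_sub_left t
  simp only [sub_self, sub_zero] at h
  exact h.continuousOn_mul (by fun_prop)

lemma integral_exp_mul_sub_rpow_le {a l t : ℝ} (ha : 0 < a) (hl : 0 < l) (ht : 0 ≤ t) :
    ∫ τ in (0 : ℝ)..t, Real.exp (l * τ) * (t - τ) ^ (a - 1) ≤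
      Real.exp (l * t) * (l ^ (-a) * Real.Gamma a) := by
  have h := intervalIntegral.integral_comp_sub_left (a := 0) (b := t)
    (fun s => Real.exp (l * t) * (s ^ (a - 1) * Real.exp (-(l * s)))) t
  have h1 : ∀ τ, Real.exp (l * τ) * (t - τ) ^ (a - 1) =
      Real.exp (l * t) * ((t - τ) ^ (a - 1) * Real.exp (-(l * (t - τ)))) := fun τ => by
    rw [mul_left_comm, ← Real.exp_add, mul_comm]
    ring_nf
  simp_rw [h1]
  rw [h, sub_self, sub_zero, intervalIntegral.integral_const_mul,
    intervalIntegral.integral_of_le ht]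
  refine mul_le_mul_of_nonneg_left ?_ (Real.exp_nonneg _)
  have h2 := Real.integral_rpow_mul_exp_neg_mul_Ioi ha hl
  rw [one_div, Real.inv_rpow hl.le, ← Real.rpow_neg hl.le] at h2
  rw [← h2]
  refine setIntegral_mono_set ?_ ?_ Ioc_subset_Ioi_self.eventuallyLE
  · have := integrableOn_rpow_mul_exp_neg_mul_rpow (p := 1) (s := a - 1) (b := l)
      (by linarith) one_pos hl
    simpa using this
  · filter_upwards [ae_restrict_mem measurableSet_Ioi] with s hs
    have : (0 : ℝ) < s := hs
    simp only [Pi.zero_apply]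
    positivity

/-- The nonlinear Duhamel integrand of a bounded function which is continuous on
`[0, T] × ℝ^N` is integrable in space and in time. -/
lemma integrable_duhamel {N : ℕ} {α p C B T t : ℝ} (hp : 0 ≤ p) (hα : -2 < α)
    (hC : ∀ s : ℝ, 0 ≤ s → ∀ x : EuclideanSpace ℝ (Fin N),
      Integrable (fun y => heatKernel N s (x - y) * ‖y‖ ^ α) ∧
      ∫ y, heatKernel N s (x - y) * ‖y‖ ^ α ≤ C * s ^ (α / 2))
    {u : ℝ → EuclideanSpace ℝ (Fin N) → ℝ}
    (huc : ContinuousOn (fun q : ℝ × EuclideanSpace ℝ (Fin N) => u q.1 q.2) (Icc 0 T ×ˢ univ))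
    (hub : ∀ t ∈ Icc (0 : ℝ) T, ∀ x, |u t x| ≤ B)
    (ht : t ∈ Icc 0 T) (x : EuclideanSpace ℝ (Fin N)) :
    (∀ τ ∈ Icc 0 t, Integrable
      (fun y => heatKernel N (t - τ) (x - y) * ‖y‖ ^ α * |u τ y| ^ p)) ∧
    IntervalIntegrable
      (fun τ => ∫ y, heatKernel N (t - τ) (x - y) * ‖y‖ ^ α * |u τ y| ^ p) volume 0 t := by
  have hT : 0 ≤ T := ht.1.trans ht.2
  have hB : 0 ≤ B := (abs_nonneg _).trans (hub t ht 0)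
  have hmem : ∀ {τ}, τ ∈ Icc 0 t → τ ∈ Icc 0 T := fun h => ⟨h.1, h.2.trans ht.2⟩
  let e : ℝ → ℝ := fun τ => projIcc 0 T hT τ
  have he : ∀ τ ∈ Icc 0 T, e τ = τ := fun τ hτ => by
    simp only [e, projIcc_of_mem hT hτ]
  have hu' : Continuous fun q : ℝ × EuclideanSpace ℝ (Fin N) => u (e q.1) q.2 := by
    refine huc.comp_continuous (f := fun q : ℝ × EuclideanSpace ℝ (Fin N) => (e q.1, q.2)) ?_ ?_
    · exact (continuous_subtype_val.comp (continuous_projIcc.comp continuous_fst)).prodMk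
        continuous_snd
    · exact fun q => ⟨(projIcc 0 T hT q.1).2, mem_univ _⟩
  have hmeas : Measurable (Function.uncurry fun (τ : ℝ) (y : EuclideanSpace ℝ (Fin N)) =>
      heatKernel N (t - τ) (x - y) * ‖y‖ ^ α * |u (e τ) y| ^ p) := by
    have h1 : Measurable fun q : ℝ × EuclideanSpace ℝ (Fin N) =>
        heatKernel N (t - q.1) (x - q.2) :=
      (measurable_heatKernel N).comp
        ((measurable_const.sub measurable_fst).prodMk (measurable_const.sub measurable_snd))
    have h2 : Measurable fun q : ℝ × EuclideanSpace ℝ (Fin N) => |u (e q.1) q.2| ^ p :=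
      (hu'.abs.rpow_const fun _ => Or.inr hp).measurable
    exact (h1.mul (by fun_prop)).mul h2
  have hle : ∀ τ ∈ Icc 0 t, ∀ y, ‖heatKernel N (t - τ) (x - y) * ‖y‖ ^ α * |u τ y| ^ p‖ ≤
      heatKernel N (t - τ) (x - y) * ‖y‖ ^ α * B ^ p := by
    intro τ hτ y
    have h0 := heatKernel_nonneg N (sub_nonneg.2 hτ.2) (x - y)
    rw [Real.norm_of_nonneg (by positivity)]
    exact mul_le_mul_of_nonneg_left
      (Real.rpow_le_rpow (abs_nonneg _) (hub τ (hmem hτ) y) hp) (by positivity)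
  refine ⟨fun τ hτ => ?_, ?_⟩
  · refine ((hC _ (sub_nonneg.2 hτ.2) x).1.mul_const (B ^ p)).mono' ?_
      (Filter.Eventually.of_forall (hle τ hτ))
    have := hmeas.of_uncurry_left (x := τ)
    simp only [he τ (hmem hτ)] at this
    exact this.aestronglyMeasurable
  · have hg := (intervalIntegrable_exp_mul_sub_rpow (a := α / 2 + 1) (by linarith) 0 t).const_mul
      (B ^ p * C)
    refine hg.mono_fun' ?_ ?_
    · have h := (hmeas.stronglyMeasurable.integral_prod_right (ν := volume)).aestronglyMeasurable
        (μ := volume.restrict (uIoc 0 t))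
      refine h.congr ?_
      filter_upwards [ae_restrict_mem measurableSet_uIoc] with τ hτ
      rw [uIoc_of_le ht.1] at hτ
      simp only [he τ (hmem (Ioc_subset_Icc_self hτ))]
    · filter_upwards [ae_restrict_mem measurableSet_uIoc] with τ hτ
      rw [uIoc_of_le ht.1] at hτ
      have hτ := Ioc_subset_Icc_self hτ
      obtain ⟨h1, h2⟩ := hC _ (sub_nonneg.2 hτ.2) x
      refine (norm_integral_le_of_norm_le (h1.mul_const (B ^ p))
        (Filter.Eventually.of_forall (hle τ hτ))).trans ?_
      rw [integral_mul_const]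
      simp only [zero_mul, Real.exp_zero, one_mul, add_sub_cancel_right]
      calc _ ≤ C * (t - τ) ^ (α / 2) * B ^ p := by gcongr
        _ = _ := by ring

/-- Unconditional uniqueness of bounded continuous mild solutions. -/
theorem stmt_4 (N : ℕ) (hN : 3 ≤ N) (α p σ m : ℝ) (hα1 : -2 < α) (hα2 : α ≤ 0)
    (hσ : -1 < σ) (hp : 1 < p)
    (w : EuclideanSpace ℝ (Fin N) → ℝ) (hwc : Continuous w)
    (hwb : ∃ B : ℝ, ∀ x, |w x| ≤ B)
    (T : ℝ) (hT : 0 < T)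
    (u₀ : EuclideanSpace ℝ (Fin N) → ℝ) (hu₀c : Continuous u₀)
    (hu₀b : ∃ B : ℝ, ∀ x, |u₀ x| ≤ B)
    (u v : ℝ → EuclideanSpace ℝ (Fin N) → ℝ)
    (hu : IsMildSolution N α p σ m T w u₀ u)
    (hv : IsMildSolution N α p σ m T w u₀ v) :
    ∀ t ∈ Set.Icc (0 : ℝ) T, ∀ x, u t x = v t x := by
  obtain ⟨huc, ⟨Bu, hBu⟩, hu0, hud⟩ := hu
  obtain ⟨hvc, ⟨Bv, hBv⟩, hv0, hvd⟩ := hv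
  have hNα : -(N : ℝ) < α := by
    have : (3 : ℝ) ≤ N := by exact_mod_cast hN
    linarith
  obtain ⟨C, hC0, hC⟩ :=
    exists_integral_heatKernel_mul_norm_rpow_le (N := N) (by omega) hNα hα2
  set M := max Bu Bv
  have huM : ∀ t ∈ Icc 0 T, ∀ x, |u t x| ≤ M := fun t ht x =>
    (hBu t ht x).trans (le_max_left _ _)
  have hvM : ∀ t ∈ Icc 0 T, ∀ x, |v t x| ≤ M := fun t ht x =>
    (hBv t ht x).trans (le_max_right _ _)
  have hM : 0 ≤ M := (abs_nonneg _).trans (huM 0 ⟨le_rfl, hT.le⟩ 0)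
  set L := p * M ^ (p - 1)
  have hL : 0 ≤ L := by positivity
  set a := α / 2 + 1 with ha_def
  have ha : 0 < a := by linarith
  have haα : a - 1 = α / 2 := by ring
  obtain ⟨l, hl, hl0⟩ : ∃ l : ℝ, L * C * (l ^ (-a) * Real.Gamma a) ≤ 1 / 2 ∧ 0 < l := by
    have h := ((tendsto_rpow_neg_atTop ha).mul_const (Real.Gamma a)).const_mul (L * C)
    rw [zero_mul, mul_zero] at h
    exact ((h.eventually_le_const (by norm_num : (0 : ℝ) < 1 / 2)).and
      (Filter.eventually_gt_atTop 0)).exists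
  have contraction : ∀ K : ℝ, 0 ≤ K →
      (∀ t ∈ Icc 0 T, ∀ x, |u t x - v t x| ≤ K * Real.exp (l * t)) →
      ∀ t ∈ Icc 0 T, ∀ x, |u t x - v t x| ≤ K / 2 * Real.exp (l * t) := by
    intro K hK h t ht x
    rcases ht.1.eq_or_lt with rfl | ht0
    · rw [hu0, hv0, sub_self, abs_zero]
      positivity
    obtain ⟨hu1, hu2⟩ := integrable_duhamel (by linarith : 0 ≤ p) hα1 hC huc huM ht x
    obtain ⟨hv1, hv2⟩ := integrable_duhamel (by linarith : 0 ≤ p) hα1 hC hvc hvM ht x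
    have hsub : u t x - v t x = ∫ τ in (0 : ℝ)..t,
        ((∫ y, heatKernel N (t - τ) (x - y) * ‖y‖ ^ α * |u τ y| ^ p) -
          ∫ y, heatKernel N (t - τ) (x - y) * ‖y‖ ^ α * |v τ y| ^ p) := by
      rw [hud t ⟨ht0, ht.2⟩, hvd t ⟨ht0, ht.2⟩, intervalIntegral.integral_sub hu2 hv2]
      ring
    have hbound : ∀ τ ∈ Ioc 0 t,
        ‖(∫ y, heatKernel N (t - τ) (x - y) * ‖y‖ ^ α * |u τ y| ^ p) -
          ∫ y, heatKernel N (t - τ) (x - y) * ‖y‖ ^ α * |v τ y| ^ p‖ ≤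
        L * C * K * (Real.exp (l * τ) * (t - τ) ^ (a - 1)) := by
      intro τ hτ'
      have hτ := Ioc_subset_Icc_self hτ'
      have hτT : τ ∈ Icc 0 T := ⟨hτ.1, hτ.2.trans ht.2⟩
      obtain ⟨h1, h2⟩ := hC _ (sub_nonneg.2 hτ.2) x
      rw [← integral_sub (hu1 τ hτ) (hv1 τ hτ)]
      refine (norm_integral_le_of_norm_le (h1.mul_const (L * (K * Real.exp (l * τ))))
        (Filter.Eventually.of_forall fun y => ?_)).trans ?_
      · have h0 := heatKernel_nonneg N (sub_nonneg.2 hτ.2) (x - y)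
        rw [← mul_sub, norm_mul, Real.norm_of_nonneg (by positivity), Real.norm_eq_abs]
        refine mul_le_mul_of_nonneg_left ?_ (by positivity)
        exact (abs_abs_rpow_sub_abs_rpow_le hp.le (huM τ hτT y) (hvM τ hτT y)).trans
          (mul_le_mul_of_nonneg_left (h τ hτT y) hL)
      · rw [integral_mul_const, haα]
        calc _ ≤ C * (t - τ) ^ (α / 2) * (L * (K * Real.exp (l * τ))) := by gcongr
          _ = _ := by ring
    rw [hsub, ← Real.norm_eq_abs]
    calc _ ≤ ∫ τ in (0 : ℝ)..t, L * C * K * (Real.exp (l * τ) * (t - τ) ^ (a - 1)) :=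
          intervalIntegral.norm_integral_le_of_norm_le ht.1
            (Filter.Eventually.of_forall hbound)
            ((intervalIntegrable_exp_mul_sub_rpow ha l t).const_mul _)
      _ ≤ L * C * K * (Real.exp (l * t) * (l ^ (-a) * Real.Gamma a)) := by
          rw [intervalIntegral.integral_const_mul]
          exact mul_le_mul_of_nonneg_left (integral_exp_mul_sub_rpow_le ha hl0 ht.1)
            (by positivity)
      _ = L * C * (l ^ (-a) * Real.Gamma a) * (K * Real.exp (l * t)) := by ring
      _ ≤ 1 / 2 * (K * Real.exp (l * t)) := by gcongr
      _ = _ := by ring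
  have decay : ∀ n : ℕ, ∀ t ∈ Icc 0 T, ∀ x,
      |u t x - v t x| ≤ 2 * M * (1 / 2) ^ n * Real.exp (l * t) := by
    intro n
    induction n with
    | zero =>
      intro t ht x
      have h1 : 1 ≤ Real.exp (l * t) := Real.one_le_exp (mul_nonneg hl0.le ht.1)
      have h2 := abs_sub (u t x) (v t x)
      have h3 := huM t ht x
      have h4 := hvM t ht x
      rw [pow_zero, mul_one]
      nlinarith
    | succ n ih =>
      intro t ht x
      refine (contraction _ (by positivity) ih t ht x).trans_eq ?_
      ring
  intro t ht x
  have hlim : Filter.Tendsto (fun n : ℕ => 2 * M * (1 / 2 : ℝ) ^ n * Real.exp (l * t))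
      Filter.atTop (nhds 0) := by
    have h := ((tendsto_pow_atTop_nhds_zero_of_lt_one (r := (1 / 2 : ℝ)) (by norm_num)
      (by norm_num)).const_mul (2 * M)).mul_const (Real.exp (l * t))
    simpa using h
  have h0 : |u t x - v t x| ≤ 0 := ge_of_tendsto' hlim fun n => decay n t ht x
  exact sub_eq_zero.1 (abs_nonpos_iff.1 h0)
end

section
/- Let N ≥ 3, −2 < α ≤ 0, p > 1, let σ > −1, m ∈ ℝ, and let w : ℝ^N → ℝ be bounded and continuous. Then for every bounded continuous u₀ : ℝ^N → ℝ there exists T > 0 and a bounded continuous mild solution u on [0,T] of u_t − Δu = |x|^α |u|^p + ζ(t) w(x) with initial data u₀. -/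
open MeasureTheory Real Set

open Metric Topology Filter Module
open scoped ENNReal NNReal

local notation "𝔼" N:max => EuclideanSpace ℝ (Fin N)

lemma heatKernel_nonneg_s5 {N : ℕ} {t : ℝ} (ht : 0 ≤ t) (x : 𝔼 N) : 0 ≤ heatKernel N t x := by
  unfold heatKernel; positivity

lemma continuous_heatKernel (N : ℕ) (t : ℝ) : Continuous (heatKernel N t) := by
  unfold heatKernel; fun_prop

lemma heatKernel_one_le (N : ℕ) (x : 𝔼 N) :
    heatKernel N 1 x ≤ (4 * π * 1) ^ (-(N : ℝ) / 2) := by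
  unfold heatKernel
  refine mul_le_of_le_one_right (by positivity) (exp_le_one_iff.2 ?_)
  rw [neg_div]
  exact neg_nonpos.2 (by positivity)

lemma integrable_heatKernel_one (N : ℕ) : Integrable (heatKernel N 1) := by
  unfold heatKernel
  refine Integrable.const_mul ?_ _
  have h := GaussianFourier.integral_rexp_neg_mul_sq_norm (V := 𝔼 N) (b := 1 / 4) (by norm_num)
  refine (Integrable.of_integral_ne_zero (h.trans_ne (by positivity))).congr (ae_of_all _ fun x => ?_)
  ring_nf

/-- The heat kernel at time one, as a measure. -/
noncomputable def heatMeasure (N : ℕ) : Measure (𝔼 N) :=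
  volume.withDensity fun z => ENNReal.ofReal (heatKernel N 1 z)

instance (N : ℕ) : IsProbabilityMeasure (heatMeasure N) := by
  have h := GaussianFourier.integral_rexp_neg_mul_sq_norm (V := 𝔼 N) (b := 1 / 4) (by norm_num)
  have h1 : ∫ z, heatKernel N 1 z = 1 := by
    unfold heatKernel
    rw [integral_const_mul]
    have : ∀ z : 𝔼 N, -‖z‖ ^ 2 / (4 * 1) = -(1 / 4) * ‖z‖ ^ 2 := fun z => by ring
    simp only [this, h]
    rw [finrank_euclideanSpace_fin, show π / (1 / 4) = 4 * π * 1 by ring,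
      ← rpow_add (by positivity), neg_div, neg_add_cancel, rpow_zero]
  refine ⟨?_⟩
  rw [heatMeasure, withDensity_apply _ MeasurableSet.univ, setLIntegral_univ,
    ← ofReal_integral_eq_lintegral_ofReal (integrable_heatKernel_one N)
      (ae_of_all _ fun z => heatKernel_nonneg_s5 zero_le_one z), h1, ENNReal.ofReal_one]

lemma heatMeasure_absolutelyContinuous (N : ℕ) : heatMeasure N ≪ volume :=
  withDensity_absolutelyContinuous _ _

lemma lintegral_heatMeasure_le (N : ℕ) (f : 𝔼 N → ℝ≥0∞) :
    ∫⁻ z, f z ∂heatMeasure N ≤ ENNReal.ofReal ((4 * π * 1) ^ (-(N : ℝ) / 2)) * ∫⁻ z, f z := by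
  rw [heatMeasure, ← smul_eq_mul, ← lintegral_smul_measure]
  refine lintegral_mono' (Measure.le_iff.2 fun s hs => ?_) le_rfl
  rw [withDensity_apply _ hs, Measure.smul_apply, smul_eq_mul]
  refine (lintegral_mono fun z => ENNReal.ofReal_le_ofReal (heatKernel_one_le N z)).trans ?_
  simp

lemma integral_heatMeasure (N : ℕ) (f : 𝔼 N → ℝ) :
    ∫ z, f z ∂heatMeasure N = ∫ z, heatKernel N 1 z * f z := by
  rw [heatMeasure, integral_withDensity_eq_integral_toReal_smul
    (continuous_heatKernel N 1).measurable.ennreal_ofReal (by simp)]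
  refine integral_congr_ae (ae_of_all _ fun z => ?_)
  simp [ENNReal.toReal_ofReal (heatKernel_nonneg_s5 zero_le_one z)]

lemma heatKernel_sqrt_smul {N : ℕ} {t : ℝ} (ht : 0 < t) (z : 𝔼 N) :
    heatKernel N t (√t • z) = (√t ^ N)⁻¹ * heatKernel N 1 z := by
  unfold heatKernel
  have h : √t ^ N = t ^ ((N : ℝ) / 2) := by
    rw [← rpow_natCast, sqrt_eq_rpow, ← rpow_mul ht.le]; ring_nf
  rw [h, ← rpow_neg ht.le, mul_one, mul_rpow (by positivity) ht.le, norm_smul, mul_pow,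
    Real.norm_of_nonneg (sqrt_nonneg t), sq_sqrt ht.le, mul_one,
    show -(t * ‖z‖ ^ 2) / (4 * t) = -‖z‖ ^ 2 / 4 by field_simp, neg_div]
  ring

/-- The heat semigroup at time `t`, rescaled to the heat kernel at time one. -/
lemma integral_heatKernel_sub {N : ℕ} {t : ℝ} (ht : 0 < t) (x : 𝔼 N) (f : 𝔼 N → ℝ) :
    ∫ y, heatKernel N t (x - y) * f y = ∫ z, f (x - √t • z) ∂heatMeasure N := by
  have hs : 0 < √t := sqrt_pos.2 ht
  rw [integral_heatMeasure, ← integral_sub_left_eq_self _ volume x]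
  have h := Measure.integral_comp_smul (volume : Measure (𝔼 N))
    (fun y => heatKernel N t (x - (x - y)) * f (x - y)) (√t)
  rw [finrank_euclideanSpace_fin, smul_eq_mul, abs_of_pos (by positivity)] at h
  simp only [sub_sub_cancel, heatKernel_sqrt_smul ht, mul_assoc, integral_const_mul] at h ⊢
  exact (mul_left_cancel₀ (by positivity) h).symm

/-- Space-time measure used to write the Duhamel term as a single integral. -/
noncomputable def duhamelMeasure (N : ℕ) : Measure (ℝ × 𝔼 N) :=
  (volume.restrict (Ioc 0 1)).prod (heatMeasure N)

instance (N : ℕ) : IsFiniteMeasure (duhamelMeasure N) := by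
  unfold duhamelMeasure; infer_instance

/-- The space-time point at which the Duhamel term for `(t, x)` evaluates the source. -/
noncomputable def duhamelPath {N : ℕ} (q ω : ℝ × 𝔼 N) : ℝ × 𝔼 N :=
  (q.1 * ω.1, q.2 - √(q.1 * (1 - ω.1)) • ω.2)

lemma continuous_duhamelPath (N : ℕ) :
    Continuous fun r : (ℝ × 𝔼 N) × (ℝ × 𝔼 N) => duhamelPath r.1 r.2 := by
  unfold duhamelPath; fun_prop

lemma duhamel_eq {N : ℕ} {t : ℝ} (ht : 0 < t) (x : 𝔼 N) (f : ℝ × 𝔼 N → ℝ)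
    (hf : Integrable (fun ω => f (duhamelPath (t, x) ω)) (duhamelMeasure N)) :
    (∫ τ in (0 : ℝ)..t, ∫ y, heatKernel N (t - τ) (x - y) * f (τ, y))
      = t * ∫ ω, f (duhamelPath (t, x) ω) ∂duhamelMeasure N := by
  have h := intervalIntegral.mul_integral_comp_mul_left (a := 0) (b := 1)
    (f := fun τ => ∫ y, heatKernel N (t - τ) (x - y) * f (τ, y)) t
  rw [mul_zero, mul_one] at h
  rw [← h, duhamelMeasure, integral_prod _ hf, intervalIntegral.integral_of_le zero_le_one,
    integral_Ioc_eq_integral_Ioo]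
  congr 1
  rw [integral_Ioc_eq_integral_Ioo]
  refine setIntegral_congr_fun measurableSet_Ioo fun s hs => ?_
  have : t - t * s = t * (1 - s) := by ring
  simp only [this]
  rw [integral_heatKernel_sub (mul_pos ht (sub_pos.2 hs.2)) x fun y => f (t * s, y)]
  rfl

lemma exists_lintegral_norm_sub_rpow_le {N : ℕ} (hN : 1 ≤ N) {β : ℝ} (hβ : -(N : ℝ) < β)
    (hβ0 : β ≤ 0) :
    ∃ C : ℝ, 0 ≤ C ∧ ∀ a : 𝔼 N,
      ∫⁻ z, ENNReal.ofReal (‖a - z‖ ^ β) ∂heatMeasure N ≤ ENNReal.ofReal C := by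
  have hm : Measurable fun y : 𝔼 N => ENNReal.ofReal (‖y‖ ^ β) := by fun_prop
  have hint : IntegrableOn (fun y : 𝔼 N => ‖y‖ ^ β) (ball 0 1) :=
    integrableOn_ball_of_norm_le_rpow (α := -β) (C := 1) (by simpa using hN)
      (by rw [finrank_euclideanSpace_fin]; linarith)
      (ae_of_all _ fun y => by rw [Real.norm_of_nonneg (by positivity), neg_neg, one_mul])
      (Measurable.aestronglyMeasurable (by fun_prop))
  set K : ℝ≥0∞ := heatMeasure N univ + ENNReal.ofReal ((4 * π * 1) ^ (-(N : ℝ) / 2)) *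
    ∫⁻ y : 𝔼 N, (ball 0 1).indicator (fun y => ENNReal.ofReal (‖y‖ ^ β)) y with hK
  have hKtop : K ≠ ∞ := by
    refine ENNReal.add_ne_top.2 ⟨measure_ne_top _ _, ENNReal.mul_ne_top ENNReal.ofReal_ne_top ?_⟩
    rw [lintegral_indicator measurableSet_ball]
    exact hint.lintegral_lt_top.ne
  refine ⟨K.toReal, ENNReal.toReal_nonneg, fun a => ?_⟩
  rw [ENNReal.ofReal_toReal hKtop]
  have hpt : ∀ y : 𝔼 N, ENNReal.ofReal (‖y‖ ^ β) ≤
      1 + (ball 0 1).indicator (fun y => ENNReal.ofReal (‖y‖ ^ β)) y := fun y => by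
    by_cases hy : y ∈ ball (0 : 𝔼 N) 1
    · rw [indicator_of_mem hy]; exact le_add_self
    · refine le_add_right (ENNReal.ofReal_le_one.2 (rpow_le_one_of_one_le_of_nonpos ?_ hβ0))
      simpa using hy
  have hmi : Measurable fun y : 𝔼 N =>
      (ball 0 1).indicator (fun y => ENNReal.ofReal (‖y‖ ^ β)) y := hm.indicator measurableSet_ball
  calc ∫⁻ z, ENNReal.ofReal (‖a - z‖ ^ β) ∂heatMeasure N
      ≤ ∫⁻ z, (1 + (ball 0 1).indicator (fun y => ENNReal.ofReal (‖y‖ ^ β)) (a - z))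
          ∂heatMeasure N := lintegral_mono fun z => hpt (a - z)
    _ = heatMeasure N univ + ∫⁻ z, (ball 0 1).indicator
          (fun y => ENNReal.ofReal (‖y‖ ^ β)) (a - z) ∂heatMeasure N := by
        rw [lintegral_add_left measurable_const, lintegral_const, one_mul]
    _ ≤ K := by
        rw [hK]
        gcongr
        refine (lintegral_heatMeasure_le N _).trans_eq ?_
        rw [lintegral_sub_left_eq_self (μ := volume)
          ((ball 0 1).indicator fun y : 𝔼 N => ENNReal.ofReal (‖y‖ ^ β)) a]

lemma exists_lintegral_norm_sub_smul_rpow_le {N : ℕ} (hN : 1 ≤ N) {β : ℝ}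
    (hβ : -(N : ℝ) < β) (hβ0 : β ≤ 0) :
    ∃ C : ℝ, 0 ≤ C ∧ ∀ r : ℝ, 0 < r → ∀ x : 𝔼 N,
      ∫⁻ z, ENNReal.ofReal (‖x - r • z‖ ^ β) ∂heatMeasure N ≤ ENNReal.ofReal (C * r ^ β) := by
  obtain ⟨C, hC, h⟩ := exists_lintegral_norm_sub_rpow_le hN hβ hβ0
  refine ⟨C, hC, fun r hr x => ?_⟩
  have hz : ∀ z : 𝔼 N, ENNReal.ofReal (‖x - r • z‖ ^ β) =
      ENNReal.ofReal (r ^ β) * ENNReal.ofReal (‖r⁻¹ • x - z‖ ^ β) := fun z => by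
    rw [← ENNReal.ofReal_mul (by positivity), ← mul_rpow hr.le (norm_nonneg _)]
    nth_rewrite 2 [← Real.norm_of_nonneg hr.le]
    rw [← norm_smul, smul_sub, smul_inv_smul₀ hr.ne']
  simp only [hz]
  rw [lintegral_const_mul _ (by fun_prop), mul_comm C, ENNReal.ofReal_mul (by positivity)]
  gcongr
  exact h _

lemma exists_lintegral_duhamelPath_rpow_le {N : ℕ} (hN : 3 ≤ N) {β : ℝ} (hβ : -2 < β)
    (hβ0 : β ≤ 0) :
    ∃ C : ℝ, 0 ≤ C ∧ ∀ t : ℝ, 0 < t → ∀ x : 𝔼 N,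
      ∫⁻ ω, ENNReal.ofReal (‖(duhamelPath (t, x) ω).2‖ ^ β) ∂duhamelMeasure N
        ≤ ENNReal.ofReal (C * t ^ (β / 2)) := by
  have hN' : (3 : ℝ) ≤ N := by exact_mod_cast hN
  obtain ⟨C, hC, h⟩ := exists_lintegral_norm_sub_smul_rpow_le (N := N) (β := β) (by lia)
    (by linarith) hβ0
  have hint : IntegrableOn (fun s : ℝ => (1 - s) ^ (β / 2)) (Ioc 0 1) := by
    have := (intervalIntegral.intervalIntegrable_rpow' (a := 0) (b := 1) (r := β / 2)
      (by linarith)).comp_sub_left 1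
    rw [sub_zero, sub_self] at this
    exact (intervalIntegrable_iff_integrableOn_Ioc_of_le zero_le_one).1 this.symm
  set M : ℝ := ∫ s in Ioc (0 : ℝ) 1, (1 - s) ^ (β / 2) with hM
  have hnn : ∀ s ∈ Ioc (0 : ℝ) 1, 0 ≤ (1 - s) ^ (β / 2) := fun s hs =>
    rpow_nonneg (sub_nonneg.2 hs.2) _
  have hM0 : 0 ≤ M := setIntegral_nonneg measurableSet_Ioc hnn
  have hMl : ∫⁻ s in Ioc (0 : ℝ) 1, ENNReal.ofReal ((1 - s) ^ (β / 2)) = ENNReal.ofReal M :=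
    (ofReal_integral_eq_lintegral_ofReal hint
      ((ae_restrict_iff' measurableSet_Ioc).2 (ae_of_all _ hnn))).symm
  refine ⟨C * M, by positivity, fun t ht x => ?_⟩
  have hmeas : Measurable fun ω : ℝ × 𝔼 N =>
      ENNReal.ofReal (‖(duhamelPath (t, x) ω).2‖ ^ β) := by
    unfold duhamelPath; fun_prop
  have hone : ∀ᵐ s : ℝ ∂volume.restrict (Ioc 0 1), s ∈ Ioo (0 : ℝ) 1 := by
    rw [← restrict_Ioo_eq_restrict_Ioc]
    exact ae_restrict_mem measurableSet_Ioo
  rw [duhamelMeasure, lintegral_prod _ hmeas.aemeasurable]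
  calc _ ≤ ∫⁻ s in Ioc (0 : ℝ) 1,
        ENNReal.ofReal (C * t ^ (β / 2)) * ENNReal.ofReal ((1 - s) ^ (β / 2)) := by
        refine lintegral_mono_ae ?_
        filter_upwards [hone] with s hs
        have hs1 : 0 < 1 - s := sub_pos.2 hs.2
        refine (h (√(t * (1 - s))) (by positivity) x).trans_eq ?_
        rw [← ENNReal.ofReal_mul (by positivity), sqrt_eq_rpow, ← rpow_mul (by positivity),
          show 1 / 2 * β = β / 2 by ring, mul_rpow ht.le hs1.le, mul_assoc]
    _ = _ := by
        rw [lintegral_const_mul _ (by fun_prop), hMl, ← ENNReal.ofReal_mul (by positivity)]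
        ring_nf

lemma ae_duhamelPath_ne_zero {N : ℕ} (hN : 1 ≤ N) {t : ℝ} (ht : 0 < t) (x : 𝔼 N) :
    ∀ᵐ ω ∂duhamelMeasure N, (duhamelPath (t, x) ω).2 ≠ 0 := by
  have : Nonempty (Fin N) := ⟨⟨0, hN⟩⟩
  have hms : MeasurableSet {ω : ℝ × 𝔼 N | (duhamelPath (t, x) ω).2 ≠ 0} := by
    have : Measurable fun ω : ℝ × 𝔼 N => (duhamelPath (t, x) ω).2 := by
      unfold duhamelPath; fun_prop
    exact this (measurableSet_singleton 0).compl
  rw [duhamelMeasure, Measure.ae_prod_iff_ae_ae hms, ← restrict_Ioo_eq_restrict_Ioc]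
  filter_upwards [ae_restrict_mem measurableSet_Ioo] with s hs
  have hr : 0 < √(t * (1 - s)) := sqrt_pos.2 (mul_pos ht (sub_pos.2 hs.2))
  refine (heatMeasure_absolutelyContinuous N).ae_le ?_
  filter_upwards [Measure.ae_ne volume ((√(t * (1 - s)))⁻¹ • x)] with z hz h0
  refine hz ?_
  have h0' : x = √(t * (1 - s)) • z := sub_eq_zero.1 h0
  rw [h0']
  exact (inv_smul_smul₀ hr.ne' z).symm

lemma exists_integral_duhamelPath_rpow_le {N : ℕ} (hN : 3 ≤ N) {β : ℝ} (hβ : -2 < β)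
    (hβ0 : β ≤ 0) :
    ∃ C : ℝ, 0 ≤ C ∧ ∀ t : ℝ, 0 < t → ∀ x : 𝔼 N,
      Integrable (fun ω => ‖(duhamelPath (t, x) ω).2‖ ^ β) (duhamelMeasure N) ∧
      ∫ ω, ‖(duhamelPath (t, x) ω).2‖ ^ β ∂duhamelMeasure N ≤ C * t ^ (β / 2) := by
  obtain ⟨C, hC, h⟩ := exists_lintegral_duhamelPath_rpow_le hN hβ hβ0
  refine ⟨C, hC, fun t ht x => ?_⟩
  have hm : AEStronglyMeasurable (fun ω => ‖(duhamelPath (t, x) ω).2‖ ^ β)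
      (duhamelMeasure N) := by
    refine Measurable.aestronglyMeasurable ?_
    unfold duhamelPath; fun_prop
  have h0 : ∀ᵐ ω ∂duhamelMeasure N, 0 ≤ ‖(duhamelPath (t, x) ω).2‖ ^ β :=
    ae_of_all _ fun ω => by positivity
  refine ⟨⟨hm, (hasFiniteIntegral_iff_ofReal h0).2 ((h t ht x).trans_lt ENNReal.ofReal_lt_top)⟩, ?_⟩
  rw [integral_eq_lintegral_of_nonneg_ae h0 hm]
  exact ENNReal.toReal_le_of_le_ofReal (by positivity) (h t ht x)

lemma integrable_rpow_mul_comp_duhamelPath {N : ℕ} (hN : 3 ≤ N) {β : ℝ} (hβ : -2 < β)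
    (hβ0 : β ≤ 0) {g : ℝ × 𝔼 N → ℝ} (hg : Continuous g) {B : ℝ} (hB : ∀ q, |g q| ≤ B)
    {t : ℝ} (ht : 0 < t) (x : 𝔼 N) :
    Integrable (fun ω => ‖(duhamelPath (t, x) ω).2‖ ^ β * g (duhamelPath (t, x) ω))
      (duhamelMeasure N) := by
  obtain ⟨C, -, h⟩ := exists_integral_duhamelPath_rpow_le hN hβ hβ0
  have hP : Continuous (duhamelPath (t, x)) :=
    (continuous_duhamelPath N).comp (Continuous.prodMk_right (t, x))
  exact (h t ht x).1.mul_bdd (hg.comp hP).aestronglyMeasurable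
    (ae_of_all _ fun ω => (Real.norm_eq_abs _).trans_le (hB _))

/-- Duhamel integrals of sources singular at the origin gain a power of `t`. -/
lemma exists_abs_mul_integral_rpow_mul_le {N : ℕ} (hN : 3 ≤ N) {β : ℝ} (hβ : -2 < β)
    (hβ0 : β ≤ 0) :
    ∃ C : ℝ, 0 ≤ C ∧ ∀ (f : ℝ × 𝔼 N → ℝ) (B t : ℝ) (x : 𝔼 N), 0 ≤ B → 0 ≤ t →
      (∀ q : ℝ × 𝔼 N, q.2 ≠ 0 → |f q| ≤ B * ‖q.2‖ ^ β) →
      |t * ∫ ω, f (duhamelPath (t, x) ω) ∂duhamelMeasure N| ≤ B * C * t ^ (1 + β / 2) := by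
  obtain ⟨C, hC, h⟩ := exists_integral_duhamelPath_rpow_le hN hβ hβ0
  refine ⟨C, hC, fun f B t x hB ht hf => ?_⟩
  rcases ht.eq_or_lt with rfl | ht
  · rw [zero_mul, abs_zero]; positivity
  have key : |∫ ω, f (duhamelPath (t, x) ω) ∂duhamelMeasure N|
      ≤ ∫ ω, B * ‖(duhamelPath (t, x) ω).2‖ ^ β ∂duhamelMeasure N := by
    rw [← Real.norm_eq_abs]
    refine norm_integral_le_of_norm_le ((h t ht x).1.const_mul B) ?_
    filter_upwards [ae_duhamelPath_ne_zero (by lia) ht x] with ω hω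
    exact hf _ hω
  rw [integral_const_mul] at key
  rw [abs_mul, abs_of_pos ht, rpow_add ht, rpow_one]
  calc _ ≤ t * (B * (C * t ^ (β / 2))) := by
        gcongr
        exact key.trans (mul_le_mul_of_nonneg_left (h t ht x).2 hB)
    _ = _ := by ring

lemma integrable_comp_fst_duhamelMeasure (N : ℕ) {φ : ℝ → ℝ} (hφ : IntegrableOn φ (Ioc 0 1)) :
    Integrable (fun ω => φ ω.1) (duhamelMeasure N) :=
  Integrable.comp_fst hφ _

lemma continuous_integral_comp_duhamelPath {N : ℕ} {φ : ℝ → ℝ} (hφ : IntegrableOn φ (Ioc 0 1))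
    {g : ℝ × 𝔼 N → ℝ} (hg : Continuous g) {B : ℝ} (hB : ∀ q, |g q| ≤ B) :
    Continuous fun q => ∫ ω, φ ω.1 * g (duhamelPath q ω) ∂duhamelMeasure N := by
  have hi := integrable_comp_fst_duhamelMeasure N hφ
  refine continuous_of_dominated (bound := fun ω => |φ ω.1| * B) (fun q => ?_) (fun q => ?_)
    (hi.abs.mul_const B) (ae_of_all _ fun ω => ?_)
  · exact hi.aestronglyMeasurable.mul (hg.comp ((continuous_duhamelPath N).comp
      (Continuous.prodMk_right q))).aestronglyMeasurable
  · refine ae_of_all _ fun ω => ?_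
    rw [norm_mul]
    exact mul_le_mul_of_nonneg_left (hB _) (norm_nonneg _)
  · exact continuous_const.mul (hg.comp ((continuous_duhamelPath N).comp
      (Continuous.prodMk_left ω)))

lemma abs_rpow_sub_rpow_max_le {α ε δ r : ℝ} (hα : α ≤ 0) (hε : 0 ≤ ε) (hr : 0 < r) (hδ : 0 < δ) :
    |r ^ α - (max r δ) ^ α| ≤ δ ^ ε * r ^ (α - ε) := by
  rcases le_total δ r with h | h
  · rw [max_eq_left h, sub_self, abs_zero]; positivity
  · rw [max_eq_right h, abs_of_nonneg (sub_nonneg.2 (rpow_le_rpow_of_nonpos hr h hα))]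
    calc r ^ α - δ ^ α ≤ r ^ α := sub_le_self _ (by positivity)
      _ = r ^ ε * r ^ (α - ε) := by rw [← rpow_add hr]; ring_nf
      _ ≤ _ := by gcongr

lemma continuous_mul_integral_rpow_mul {N : ℕ} (hN : 3 ≤ N) {α : ℝ} (hα : -2 < α)
    (hα0 : α ≤ 0) {g : ℝ × 𝔼 N → ℝ} (hg : Continuous g) {B : ℝ} (hB : ∀ q, |g q| ≤ B)
    {c : ℝ → ℝ} (hc : Continuous c) (hc0 : ∀ t, 0 ≤ c t) (hc1 : ∀ t, c t ≤ 1) :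
    Continuous fun q : ℝ × 𝔼 N => c q.1 * ∫ ω, ‖(duhamelPath (c q.1, q.2) ω).2‖ ^ α *
      g (duhamelPath (c q.1, q.2) ω) ∂duhamelMeasure N := by
  have hB0 : 0 ≤ B := (abs_nonneg _).trans (hB 0)
  set ε := (α + 2) / 2 with hε
  have hε0 : 0 < ε := by linarith
  obtain ⟨C, hC, h⟩ := exists_abs_mul_integral_rpow_mul_le hN (β := α - ε) (by linarith)
    (by linarith)
  refine continuous_of_uniform_approx_of_continuous fun U hU => ?_
  obtain ⟨e, he, heU⟩ := Metric.mem_uniformity_dist.1 hU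
  set η := e / (B * C + 1) with hη
  have hη0 : 0 < η := by positivity
  set δ := η ^ ε⁻¹ with hδ
  have hδ0 : 0 < δ := by positivity
  have hδε : δ ^ ε = η := by rw [hδ, ← rpow_mul hη0.le, inv_mul_cancel₀ hε0.ne', rpow_one]
  have hmax : ∀ y : 𝔼 N, 0 < max ‖y‖ δ := fun y => lt_max_of_lt_right hδ0
  have hgδ : Continuous fun q : ℝ × 𝔼 N => (max ‖q.2‖ δ) ^ α * g q := by
    have hm : Continuous fun q : ℝ × 𝔼 N => max ‖q.2‖ δ := by fun_prop
    exact (hm.rpow_const fun q => Or.inl (hmax q.2).ne').mul hg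
  have hgδB : ∀ q : ℝ × 𝔼 N, |(max ‖q.2‖ δ) ^ α * g q| ≤ δ ^ α * B := fun q => by
    rw [abs_mul, abs_of_nonneg (rpow_nonneg (hmax q.2).le _)]
    exact mul_le_mul (rpow_le_rpow_of_nonpos hδ0 (le_max_right _ _) hα0) (hB q) (abs_nonneg _)
      (by positivity)
  have hcont := continuous_integral_comp_duhamelPath (φ := fun _ => 1)
    (integrable_const (1 : ℝ)) hgδ hgδB
  refine ⟨fun q => c q.1 * ∫ ω, 1 * ((max ‖(duhamelPath (c q.1, q.2) ω).2‖ δ) ^ α *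
      g (duhamelPath (c q.1, q.2) ω)) ∂duhamelMeasure N,
    (hc.comp continuous_fst).mul (hcont.comp (f := fun q : ℝ × 𝔼 N => (c q.1, q.2))
      (by fun_prop)), fun q => heU ?_⟩
  simp only [one_mul]
  rcases (hc0 q.1).eq_or_lt with h0 | hpos
  · simpa [← h0] using he
  have hi2 : Integrable (fun ω => (max ‖(duhamelPath (c q.1, q.2) ω).2‖ δ) ^ α *
      g (duhamelPath (c q.1, q.2) ω)) (duhamelMeasure N) :=
    Integrable.of_bound (hgδ.comp ((continuous_duhamelPath N).comp
      (Continuous.prodMk_right (c q.1, q.2)))).aestronglyMeasurable _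
      (ae_of_all _ fun ω => (Real.norm_eq_abs _).trans_le (hgδB _))
  rw [Real.dist_eq, ← mul_sub, ← integral_sub
    (integrable_rpow_mul_comp_duhamelPath hN hα hα0 hg hB hpos q.2) hi2]
  refine (h (fun p => ‖p.2‖ ^ α * g p - (max ‖p.2‖ δ) ^ α * g p) (B * η) (c q.1) q.2
    (by positivity) hpos.le fun p hp => ?_).trans_lt ?_
  · rw [← sub_mul, abs_mul, ← hδε, mul_comm, mul_assoc]
    exact mul_le_mul (hB p) (abs_rpow_sub_rpow_max_le hα0 hε0.le (norm_pos_iff.2 hp) hδ0)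
      (abs_nonneg _) hB0
  · calc B * η * C * c q.1 ^ (1 + (α - ε) / 2) ≤ B * η * C * 1 := by
          gcongr
          exact rpow_le_one hpos.le (hc1 _) (by linarith)
      _ = B * C / (B * C + 1) * e := by rw [hη]; ring
      _ < 1 * e := by
          gcongr
          rw [div_lt_one (by positivity)]; linarith
      _ = e := one_mul e

lemma continuous_integral_sub_sqrt_smul {N : ℕ} {f : 𝔼 N → ℝ} (hf : Continuous f) {B : ℝ}
    (hB : ∀ x, |f x| ≤ B) :
    Continuous fun q : ℝ × 𝔼 N => ∫ z, f (q.2 - √q.1 • z) ∂heatMeasure N := by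
  refine continuous_of_dominated (bound := fun _ => B) (fun q => ?_)
    (fun q => ae_of_all _ fun z => (Real.norm_eq_abs _).trans_le (hB _)) (integrable_const B)
    (ae_of_all _ fun z => by fun_prop)
  exact Continuous.aestronglyMeasurable (by fun_prop)

lemma abs_integral_heatMeasure_le {N : ℕ} {f : 𝔼 N → ℝ} {B : ℝ} (hB : ∀ x, |f x| ≤ B) :
    |∫ z, f z ∂heatMeasure N| ≤ B := by
  simpa using norm_integral_le_of_norm_le_const (μ := heatMeasure N)
    (ae_of_all _ fun z => (Real.norm_eq_abs (f z)).trans_le (hB z))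

lemma integrableOn_rpow_Ioc_zero_one {σ : ℝ} (hσ : -1 < σ) :
    IntegrableOn (fun s : ℝ => s ^ σ) (Ioc 0 1) :=
  (intervalIntegrable_iff_integrableOn_Ioc_of_le zero_le_one).1
    (intervalIntegral.intervalIntegrable_rpow' hσ)

lemma integrable_rpow_fst_mul_comp_duhamelPath {N : ℕ} {σ : ℝ} (hσ : -1 < σ) {w : 𝔼 N → ℝ}
    (hw : Continuous w) {B : ℝ} (hB : ∀ x, |w x| ≤ B) (q : ℝ × 𝔼 N) :
    Integrable (fun ω => ω.1 ^ σ * w (duhamelPath q ω).2) (duhamelMeasure N) :=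
  (integrable_comp_fst_duhamelMeasure N (integrableOn_rpow_Ioc_zero_one hσ)).mul_bdd
    (hw.comp (continuous_snd.comp ((continuous_duhamelPath N).comp
      (Continuous.prodMk_right q)))).aestronglyMeasurable
    (ae_of_all _ fun _ => (Real.norm_eq_abs _).trans_le (hB _))

lemma forcing_eq {N : ℕ} {σ : ℝ} (m : ℝ) (hσ : -1 < σ) {w : 𝔼 N → ℝ}
    (hw : Continuous w) {B : ℝ} (hB : ∀ x, |w x| ≤ B) {t : ℝ} (ht : 0 < t) (ht1 : t < 1)
    (x : 𝔼 N) :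
    (∫ τ in (0 : ℝ)..t, zeta σ m τ * ∫ y, heatKernel N (t - τ) (x - y) * w y)
      = t ^ (1 + σ) * ∫ ω, ω.1 ^ σ * w (duhamelPath (t, x) ω).2 ∂duhamelMeasure N := by
  have hae : (fun ω => zeta σ m (duhamelPath (t, x) ω).1 * w (duhamelPath (t, x) ω).2)
      =ᵐ[duhamelMeasure N] fun ω => t ^ σ * (ω.1 ^ σ * w (duhamelPath (t, x) ω).2) := by
    have hmem : ∀ᵐ ω ∂duhamelMeasure N, ω.1 ∈ Ioc (0 : ℝ) 1 :=
      Measure.quasiMeasurePreserving_fst.ae (ae_restrict_mem measurableSet_Ioc)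
    filter_upwards [hmem] with ω hω
    have h1 : t * ω.1 < 1 := (mul_le_of_le_one_right ht.le hω.2).trans_lt ht1
    change zeta σ m (t * ω.1) * _ = _
    rw [zeta, if_pos h1, mul_rpow ht.le hω.1.le, mul_assoc]
  have hi := integrable_rpow_fst_mul_comp_duhamelPath hσ hw hB (t, x)
  have h := duhamel_eq ht x (fun q => zeta σ m q.1 * w q.2) ((hi.const_mul _).congr hae.symm)
  rw [integral_congr_ae hae, integral_const_mul, ← mul_assoc] at h
  rw [rpow_add ht, rpow_one, ← h]
  simp only [mul_left_comm _ (zeta σ m _), integral_const_mul]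

/-- The power `|a|^p`, made globally Lipschitz by cutting off at height `R`. -/
noncomputable def cutoffPow (p R a : ℝ) : ℝ := (min |a| R) ^ p

lemma continuous_cutoffPow {p : ℝ} (hp : 1 < p) (R : ℝ) : Continuous (cutoffPow p R) := by
  have hm : Continuous fun a : ℝ => min |a| R := by fun_prop
  exact hm.rpow_const fun a => Or.inr (by linarith)

lemma abs_cutoffPow_le {p R : ℝ} (hp : 1 < p) (hR : 0 ≤ R) (a : ℝ) :
    |cutoffPow p R a| ≤ R ^ p := by
  have h0 : 0 ≤ min |a| R := le_min (abs_nonneg a) hR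
  rw [cutoffPow, abs_of_nonneg (rpow_nonneg h0 p)]
  exact rpow_le_rpow h0 (min_le_right _ _) (by linarith)

lemma cutoffPow_of_abs_le {p R a : ℝ} (h : |a| ≤ R) : cutoffPow p R a = |a| ^ p := by
  rw [cutoffPow, min_eq_left h]

lemma abs_cutoffPow_sub_le {p R : ℝ} (hp : 1 < p) (hR : 0 ≤ R) (a b : ℝ) :
    |cutoffPow p R a - cutoffPow p R b| ≤ p * R ^ (p - 1) * |a - b| := by
  have hmem : ∀ a : ℝ, min |a| R ∈ Icc 0 R := fun a =>
    ⟨le_min (abs_nonneg a) hR, min_le_right _ _⟩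
  have h := Convex.norm_image_sub_le_of_norm_hasDerivWithin_le (f := fun x : ℝ => x ^ p)
    (f' := fun x => p * x ^ (p - 1)) (C := p * R ^ (p - 1)) (s := Icc 0 R)
    (fun x _ => (hasDerivAt_rpow_const (Or.inr hp.le)).hasDerivWithinAt)
    (fun x hx => by
      rw [Real.norm_of_nonneg (mul_nonneg (by linarith) (rpow_nonneg hx.1 _))]
      exact mul_le_mul_of_nonneg_left (rpow_le_rpow hx.1 hx.2 (by linarith)) (by linarith))
    (convex_Icc 0 R) (hmem b) (hmem a)
  refine h.trans (mul_le_mul_of_nonneg_left ?_ (mul_nonneg (by linarith) (rpow_nonneg hR _)))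
  rw [Real.norm_eq_abs]
  exact (abs_min_sub_min_le_max _ _ _ _).trans (by simpa using abs_abs_sub_abs_le a b)

lemma exists_time_mul_rpow_le {a b K : ℝ} (ha : 0 < a) (hb : 0 < b) :
    ∃ T : ℝ, 0 < T ∧ T < 1 ∧ K * T ^ a ≤ 1 / 2 ∧ K * T ^ b ≤ 1 / 2 := by
  have key : ∀ c : ℝ, 0 < c → ∀ᶠ T : ℝ in 𝓝[>] 0, K * T ^ c ≤ 1 / 2 := fun c hc => by
    have hcont : ContinuousAt (fun T : ℝ => K * T ^ c) 0 :=
      continuousAt_const.mul (continuousAt_rpow_const _ _ (Or.inr hc.le))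
    have h0 : K * (0 : ℝ) ^ c < 1 / 2 := by rw [zero_rpow hc.ne']; norm_num
    exact ((hcont.eventually_lt continuousAt_const h0).filter_mono nhdsWithin_le_nhds).mono
      fun _ h => h.le
  obtain ⟨T, ⟨h1, h2⟩, h3⟩ := ((key a ha).and (key b hb)).and
    (Ioo_mem_nhdsGT (zero_lt_one' ℝ)) |>.exists
  exact ⟨T, h3.1, h3.2, h1, h2⟩

/-- Local existence of a bounded continuous mild solution. -/
theorem stmt_5 (N : ℕ) (hN : 3 ≤ N) (α p σ m : ℝ) (hα1 : -2 < α) (hα2 : α ≤ 0)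
    (hp : 1 < p) (hσ : -1 < σ)
    (w : EuclideanSpace ℝ (Fin N) → ℝ) (hwc : Continuous w)
    (hwb : ∃ B : ℝ, ∀ x, |w x| ≤ B)
    (u₀ : EuclideanSpace ℝ (Fin N) → ℝ) (hu₀c : Continuous u₀)
    (hu₀b : ∃ B : ℝ, ∀ x, |u₀ x| ≤ B) :
    ∃ T : ℝ, 0 < T ∧ ∃ u : ℝ → EuclideanSpace ℝ (Fin N) → ℝ,
      IsMildSolution N α p σ m T w u₀ u := by
  obtain ⟨Bw, hBw⟩ := hwb
  obtain ⟨B₀, hB₀⟩ := hu₀b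
  have hBw0 : 0 ≤ Bw := (abs_nonneg _).trans (hBw 0)
  have hB₀0 : 0 ≤ B₀ := (abs_nonneg _).trans (hB₀ 0)
  set R := B₀ + 1 with hR
  have hR0 : 0 ≤ R := by positivity
  set L := p * R ^ (p - 1) with hL
  have hL0 : 0 ≤ L := mul_nonneg (by linarith) (rpow_nonneg hR0 _)
  obtain ⟨C, hC, hsrc⟩ := exists_abs_mul_integral_rpow_mul_le hN hα1 hα2
  set M := ∫ ω, |ω.1 ^ σ| ∂duhamelMeasure N with hM
  have hM0 : 0 ≤ M := integral_nonneg fun ω => abs_nonneg _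
  set K := R ^ p * C + L * C + Bw * M with hK
  obtain ⟨T, hT0, hT1, hTa, hTb⟩ := exists_time_mul_rpow_le (K := K)
    (show 0 < 1 + α / 2 by linarith) (show 0 < 1 + σ by linarith)
  have hRp0 : 0 ≤ R ^ p := rpow_nonneg hR0 p
  have hKle : ∀ {k e t : ℝ}, 0 < e → 0 ≤ t → t ≤ T → k ≤ K → K * T ^ e ≤ 1 / 2 →
      0 ≤ k → k * t ^ e ≤ 1 / 2 := fun he ht htT hk h hk0 =>
    (mul_le_mul hk (rpow_le_rpow ht htT he.le) (rpow_nonneg ht _) (hk0.trans hk)).trans h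
  set c : ℝ → ℝ := fun t => max 0 (min t T) with hc
  have hcc : Continuous c := by fun_prop
  have hc0 : ∀ t, 0 ≤ c t := fun t => le_max_left _ _
  have hcT : ∀ t, c t ≤ T := fun t => max_le hT0.le (min_le_right _ _)
  have hceq : ∀ t ∈ Icc 0 T, c t = t := fun t ht => by
    simp only [hc, min_eq_left ht.2, max_eq_right ht.1]
  have hF := continuous_cutoffPow hp R
  -- the three contributions to the Duhamel map, with time clamped to `[0, T]`
  set A : ℝ × 𝔼 N → ℝ := fun q => ∫ z, u₀ (q.2 - √(c q.1) • z) ∂heatMeasure N with hA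
  set J : BoundedContinuousFunction (ℝ × 𝔼 N) ℝ → ℝ × 𝔼 N → ℝ := fun u q =>
    c q.1 * ∫ ω, ‖(duhamelPath (c q.1, q.2) ω).2‖ ^ α *
      cutoffPow p R (u (duhamelPath (c q.1, q.2) ω)) ∂duhamelMeasure N with hJ
  set W : ℝ × 𝔼 N → ℝ := fun q => c q.1 ^ (1 + σ) *
    ∫ ω, ω.1 ^ σ * w (duhamelPath (c q.1, q.2) ω).2 ∂duhamelMeasure N with hW
  have hclamp : Continuous fun q : ℝ × 𝔼 N => (c q.1, q.2) := by fun_prop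
  have hAc : Continuous A := (continuous_integral_sub_sqrt_smul hu₀c hB₀).comp hclamp
  have hJc : ∀ u, Continuous (J u) := fun u =>
    continuous_mul_integral_rpow_mul hN hα1 hα2 (hF.comp u.continuous)
      (fun q => abs_cutoffPow_le hp hR0 (u q)) hcc hc0 fun t => (hcT t).trans hT1.le
  have hWc : Continuous W :=
    ((hcc.comp continuous_fst).rpow_const fun q => Or.inr (by linarith)).mul
      ((continuous_integral_comp_duhamelPath (integrableOn_rpow_Ioc_zero_one hσ)
        (hwc.comp continuous_snd) fun q => hBw q.2).comp hclamp)
  have hAb : ∀ q, |A q| ≤ B₀ := fun q => abs_integral_heatMeasure_le fun z => hB₀ _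
  have hJb : ∀ u q, |J u q| ≤ 1 / 2 := fun u q => by
    refine (hsrc (fun q => ‖q.2‖ ^ α * cutoffPow p R (u q)) (R ^ p) (c q.1) q.2 hRp0 (hc0 _)
      fun r _ => ?_).trans ?_
    · rw [abs_mul, abs_of_nonneg (rpow_nonneg (norm_nonneg _) _), mul_comm]
      exact mul_le_mul_of_nonneg_right (abs_cutoffPow_le hp hR0 _) (by positivity)
    · exact hKle (by linarith) (hc0 _) (hcT _)
        (by linarith [mul_nonneg hL0 hC, mul_nonneg hBw0 hM0]) hTa (by positivity)
  have hWb : ∀ q, |W q| ≤ 1 / 2 := fun q => by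
    have hi := integrable_comp_fst_duhamelMeasure N (integrableOn_rpow_Ioc_zero_one hσ)
    have h1 : |∫ ω, ω.1 ^ σ * w (duhamelPath (c q.1, q.2) ω).2 ∂duhamelMeasure N| ≤ Bw * M := by
      rw [hM, ← integral_const_mul, ← Real.norm_eq_abs]
      refine norm_integral_le_of_norm_le (hi.abs.const_mul Bw) (ae_of_all _ fun ω => ?_)
      rw [norm_mul, mul_comm, Real.norm_eq_abs, Real.norm_eq_abs]
      exact mul_le_mul_of_nonneg_right (hBw _) (abs_nonneg _)
    rw [hW, abs_mul, abs_of_nonneg (rpow_nonneg (hc0 _) _), mul_comm]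
    refine (mul_le_mul_of_nonneg_right h1 (rpow_nonneg (hc0 _) _)).trans ?_
    exact hKle (by linarith) (hc0 _) (hcT _)
      (by linarith [mul_nonneg hL0 hC, mul_nonneg hRp0 hC]) hTb (by positivity)
  have hJlip : ∀ u v q, |J u q - J v q| ≤ 1 / 2 * dist u v := fun u v q => by
    rcases (hc0 q.1).eq_or_lt with h0 | hpos
    · simp only [hJ, ← h0, zero_mul, sub_self, abs_zero]
      positivity
    have hi := fun u : BoundedContinuousFunction (ℝ × 𝔼 N) ℝ =>
      integrable_rpow_mul_comp_duhamelPath hN hα1 hα2 (hF.comp u.continuous)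
        (fun q => abs_cutoffPow_le hp hR0 (u q)) hpos q.2
    have hsub : J u q - J v q = c q.1 * ∫ ω, (‖(duhamelPath (c q.1, q.2) ω).2‖ ^ α *
        cutoffPow p R (u (duhamelPath (c q.1, q.2) ω)) - ‖(duhamelPath (c q.1, q.2) ω).2‖ ^ α *
        cutoffPow p R (v (duhamelPath (c q.1, q.2) ω))) ∂duhamelMeasure N := by
      exact (mul_sub _ _ _).symm.trans (congrArg _ (integral_sub (hi u) (hi v)).symm)
    rw [hsub]
    refine (hsrc (fun q => ‖q.2‖ ^ α * cutoffPow p R (u q) - ‖q.2‖ ^ α * cutoffPow p R (v q))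
      (L * dist u v) (c q.1) q.2 (by positivity) (hc0 _) fun r _ => ?_).trans ?_
    · rw [← mul_sub, abs_mul, abs_of_nonneg (rpow_nonneg (norm_nonneg _) _), mul_comm]
      refine mul_le_mul_of_nonneg_right ((abs_cutoffPow_sub_le hp hR0 _ _).trans ?_)
        (by positivity)
      exact mul_le_mul_of_nonneg_left (u.dist_coe_le_dist r) hL0
    · rw [show L * dist u v * C * c q.1 ^ (1 + α / 2)
        = L * C * c q.1 ^ (1 + α / 2) * dist u v by ring]
      refine mul_le_mul_of_nonneg_right ?_ dist_nonneg
      exact hKle (by linarith) (hc0 _) (hcT _)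
        (by linarith [mul_nonneg hRp0 hC, mul_nonneg hBw0 hM0]) hTa (by positivity)
  have hΨb : ∀ u q, ‖A q + J u q + W q‖ ≤ R := fun u q => by
    rw [Real.norm_eq_abs]
    refine (abs_add_three _ _ _).trans ?_
    linarith [hAb q, hJb u q, hWb q]
  set Ψ : BoundedContinuousFunction (ℝ × 𝔼 N) ℝ → BoundedContinuousFunction (ℝ × 𝔼 N) ℝ :=
    fun u => BoundedContinuousFunction.ofNormedAddCommGroup (fun q => A q + J u q + W q)
      ((hAc.add (hJc u)).add hWc) R (hΨb u) with hΨ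
  have hcontr : ContractingWith (1 / 2) Ψ := by
    refine ⟨by norm_num, LipschitzWith.of_dist_le_mul fun u v => ?_⟩
    refine (BoundedContinuousFunction.dist_le (by positivity)).2 fun q => ?_
    have : A q + J u q + W q - (A q + J v q + W q) = J u q - J v q := by ring
    simpa [hΨ, Real.dist_eq, this] using hJlip u v q
  obtain ⟨u, hu⟩ : ∃ u, Ψ u = u := ⟨_, hcontr.fixedPoint_isFixedPt⟩
  have hfix : ∀ q, u q = A q + J u q + W q := fun q => (DFunLike.congr_fun hu q).symm
  have hub : ∀ q, |u q| ≤ R := fun q => by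
    rw [hfix, ← Real.norm_eq_abs]; exact hΨb u q
  refine ⟨T, hT0, fun t x => u (t, x), u.continuous.continuousOn, ⟨R, fun t _ x => hub _⟩,
    fun x => ?_, fun t ht x => ?_⟩
  · have h0 : c 0 = 0 := hceq 0 ⟨le_rfl, hT0.le⟩
    have hσ' : 1 + σ ≠ 0 := by linarith
    change u (0, x) = _
    rw [hfix]
    simp [hA, hJ, hW, h0, zero_rpow hσ']
  · have hct : c t = t := hceq t ⟨ht.1.le, ht.2⟩
    have hJeq : (∫ τ in (0 : ℝ)..t, ∫ y, heatKernel N (t - τ) (x - y) * ‖y‖ ^ α * |u (τ, y)| ^ p)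
        = J u (t, x) := by
      have h := duhamel_eq ht.1 x (fun q => ‖q.2‖ ^ α * cutoffPow p R (u q))
        (integrable_rpow_mul_comp_duhamelPath hN hα1 hα2 (hF.comp u.continuous)
          (fun q => abs_cutoffPow_le hp hR0 (u q)) ht.1 x)
      simp only [hJ, hct]
      rw [← h]
      simp only [cutoffPow_of_abs_le (hub _), mul_assoc]
    rw [hJeq, forcing_eq m hσ hwc hBw ht.1 (ht.2.trans_lt hT1), integral_heatKernel_sub ht.1]
    refine (hfix (t, x)).trans ?_
    simp only [hA, hW, hct]
end

section
/- Let N ≥ 1 and γ > 0. There exists a constant C > 0, depending only on N and γ, such that for all t ∈ (0, 1] and all x ∈ ℝ^N: ∫_{ℝ^N} G_t(x−y) (1 + |y|)^{−γ} dy ≤ C (1 + |x|)^{−γ}. -/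
open MeasureTheory Real Set

theorem integrable_rexp_neg_mul_sq_norm {V : Type*} [NormedAddCommGroup V]
    [InnerProductSpace ℝ V] [FiniteDimensional ℝ V] [MeasurableSpace V] [BorelSpace V]
    {b : ℝ} (hb : 0 < b) : Integrable (fun v : V ↦ Real.exp (-b * ‖v‖ ^ 2)) := by
  by_contra h
  have h0 := GaussianFourier.integral_rexp_neg_mul_sq_norm (V := V) hb
  rw [integral_undef h] at h0
  have : 0 < (Real.pi / b) ^ (Module.finrank ℝ V / 2 : ℝ) := by positivity
  exact this.ne h0

/-- Peetre's inequality with a negative exponent. -/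
theorem one_add_norm_rpow_neg_le {E : Type*} [SeminormedAddCommGroup E] {γ : ℝ} (hγ : 0 ≤ γ)
    (x y : E) : (1 + ‖y‖) ^ (-γ) ≤ (1 + ‖x - y‖) ^ γ * (1 + ‖x‖) ^ (-γ) := by
  have hx : 0 < 1 + ‖x‖ := by positivity
  have hy : 0 < 1 + ‖y‖ := by positivity
  have hxy : 1 + ‖x‖ ≤ (1 + ‖x - y‖) * (1 + ‖y‖) := by
    nlinarith [norm_le_norm_sub_add x y, norm_nonneg (x - y), norm_nonneg y]
  have h := Real.rpow_le_rpow hx.le hxy hγ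
  rw [Real.mul_rpow (by positivity) hy.le] at h
  rw [Real.rpow_neg hy.le, Real.rpow_neg hx.le, ← div_eq_mul_inv,
    le_div_iff₀ (by positivity), inv_mul_le_iff₀ (by positivity)]
  linarith

/-- A polynomial weight is absorbed by half of the Gaussian exponent. -/
theorem exp_neg_sq_div_mul_one_add_rpow_le {γ t r : ℝ} (hγ : 0 ≤ γ) (ht : t ∈ Ioc (0 : ℝ) 1)
    (hr : 0 ≤ r) :
    Real.exp (-r ^ 2 / (4 * t)) * (1 + r) ^ γ
      ≤ Real.exp (2 * γ ^ 2) * Real.exp (-(1 / (8 * t)) * r ^ 2) := by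
  obtain ⟨ht0, ht1⟩ := ht
  have hpow : (1 + r) ^ γ ≤ Real.exp (r * γ) := by
    rw [Real.exp_mul]
    exact Real.rpow_le_rpow (by positivity) (by linarith [Real.add_one_le_exp r]) hγ
  refine (mul_le_mul_of_nonneg_left hpow (Real.exp_pos _).le).trans ?_
  rw [← Real.exp_add, ← Real.exp_add, Real.exp_le_exp]
  have hsq : 0 ≤ (r - 4 * t * γ) ^ 2 / (8 * t) := by positivity
  have hid : (r - 4 * t * γ) ^ 2 / (8 * t)
      = 2 * t * γ ^ 2 + -(1 / (8 * t)) * r ^ 2 - (-r ^ 2 / (4 * t) + r * γ) := by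
    field_simp
    ring
  nlinarith [mul_le_mul_of_nonneg_right ht1 (sq_nonneg γ)]

theorem heatKernel_mul_one_add_norm_rpow_neg_le {N : ℕ} {γ t : ℝ} (hγ : 0 ≤ γ)
    (ht : t ∈ Ioc (0 : ℝ) 1) (x y : EuclideanSpace ℝ (Fin N)) :
    heatKernel N t (x - y) * (1 + ‖y‖) ^ (-γ)
      ≤ (4 * Real.pi * t) ^ (-(N : ℝ) / 2) * Real.exp (2 * γ ^ 2) * (1 + ‖x‖) ^ (-γ)
        * Real.exp (-(1 / (8 * t)) * ‖x - y‖ ^ 2) := by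
  have ht0 : 0 < t := ht.1
  unfold heatKernel
  calc _ ≤ (4 * Real.pi * t) ^ (-(N : ℝ) / 2) * Real.exp (-‖x - y‖ ^ 2 / (4 * t))
        * ((1 + ‖x - y‖) ^ γ * (1 + ‖x‖) ^ (-γ)) := by
        gcongr
        exact one_add_norm_rpow_neg_le hγ x y
    _ = (4 * Real.pi * t) ^ (-(N : ℝ) / 2) * (1 + ‖x‖) ^ (-γ)
        * (Real.exp (-‖x - y‖ ^ 2 / (4 * t)) * (1 + ‖x - y‖) ^ γ) := by ring
    _ ≤ (4 * Real.pi * t) ^ (-(N : ℝ) / 2) * (1 + ‖x‖) ^ (-γ)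
        * (Real.exp (2 * γ ^ 2) * Real.exp (-(1 / (8 * t)) * ‖x - y‖ ^ 2)) := by
        exact mul_le_mul_of_nonneg_left
          (exp_neg_sq_div_mul_one_add_rpow_le hγ ht (norm_nonneg (x - y))) (by positivity)
    _ = _ := by ring

/-- For `N ≥ 1` and `γ > 0` there is `C = C(N, γ) > 0` with
`∫ G_t(x-y) (1+|y|)^{-γ} dy ≤ C (1+|x|)^{-γ}` for all `t ∈ (0,1]` and `x`. -/
theorem stmt_7 (N : ℕ) (hN : 1 ≤ N) (γ : ℝ) (hγ : 0 < γ) :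
    ∃ C : ℝ, 0 < C ∧ ∀ t ∈ Set.Ioc (0 : ℝ) 1, ∀ x : EuclideanSpace ℝ (Fin N),
      (∫ y, heatKernel N t (x - y) * (1 + ‖y‖) ^ (-γ)) ≤ C * (1 + ‖x‖) ^ (-γ) := by
  refine ⟨2 ^ ((N : ℝ) / 2) * Real.exp (2 * γ ^ 2), by positivity, fun t ht x ↦ ?_⟩
  have ht0 : 0 < t := ht.1
  have hb : 0 < 1 / (8 * t) := by positivity
  have hgauss := (integrable_rexp_neg_mul_sq_norm
    (V := EuclideanSpace ℝ (Fin N)) hb).comp_sub_left x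
  refine (integral_mono_of_nonneg
    (.of_forall fun y ↦ by simp only [heatKernel, Pi.zero_apply]; positivity)
    (hgauss.const_mul _)
    (.of_forall fun y ↦ heatKernel_mul_one_add_norm_rpow_neg_le hγ.le ht x y)).trans_eq ?_
  rw [integral_const_mul,
    integral_sub_left_eq_self (fun v : EuclideanSpace ℝ (Fin N) ↦
      Real.exp (-(1 / (8 * t)) * ‖v‖ ^ 2)),
    GaussianFourier.integral_rexp_neg_mul_sq_norm hb, finrank_euclideanSpace_fin,
    show Real.pi / (1 / (8 * t)) = 2 * (4 * Real.pi * t) by field_simp; ring,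
    Real.mul_rpow zero_le_two (by positivity), neg_div, Real.rpow_neg (by positivity)]
  have hpos : 0 < (4 * Real.pi * t) ^ ((N : ℝ) / 2) := by positivity
  generalize (4 * Real.pi * t) ^ ((N : ℝ) / 2) = a at hpos ⊢
  field_simp
end

section
/- Let N ≥ 3, α > −2, m ≤ 0 and 1 < p < (N − 2m + α)/(N − 2m − 2), let σ > −1, and let w : ℝ^N → ℝ be continuous, tending to 0 at infinity, integrable, and satisfying ∫_{ℝ^N} w(x) dx > 0. Then there is no global classical solution of u_t − Δu = |x|^α |u|^p + ζ(t) w(x); that is, there is no function u : [0,∞) × ℝ^N → ℝ which is continuous, is continuously differentiable in t and twice continuously differentiable in x on (0,∞) × (ℝ^N ∖ {0}), satisfies ∂_t u(t,x) − Δu(t,x) = |x|^α |u(t,x)|^p + ζ(t) w(x) for all t > 0 and all x ≠ 0, and for which (t,x) ↦ |x|^α |u(t,x)|^p and x ↦ |x|^{−α/(p−1)} are locally integrable. -/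
open MeasureTheory Real Set Filter

/-- `u` is a global classical solution of `u_t - Δu = |x|^α |u|^p + ζ(t) w(x)`:
it is continuous on `[0,∞) × ℝ^N`, continuously differentiable in `t` and twice
continuously differentiable in `x` on `(0,∞) × (ℝ^N \ {0})`, satisfies the
equation there, and `|x|^α |u|^p` and `|x|^{-α/(p-1)}` are locally integrable. -/
def IsGlobalClassicalSolution (N : ℕ) (α p σ m : ℝ)
    (w : EuclideanSpace ℝ (Fin N) → ℝ)
    (u : ℝ → EuclideanSpace ℝ (Fin N) → ℝ) : Prop :=
  ContinuousOn (fun q : ℝ × EuclideanSpace ℝ (Fin N) => u q.1 q.2)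
      (Set.Ici 0 ×ˢ Set.univ) ∧
  (∀ t : ℝ, 0 < t → ∀ x : EuclideanSpace ℝ (Fin N), x ≠ 0 →
      DifferentiableAt ℝ (fun s => u s x) t) ∧
  ContinuousOn (fun q : ℝ × EuclideanSpace ℝ (Fin N) => deriv (fun s => u s q.2) q.1)
      (Set.Ioi 0 ×ˢ {x | x ≠ 0}) ∧
  (∀ t : ℝ, 0 < t → ContDiffOn ℝ 2 (u t) {x | x ≠ 0}) ∧
  (∀ t : ℝ, 0 < t → ∀ x : EuclideanSpace ℝ (Fin N), x ≠ 0 →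
      deriv (fun s => u s x) t
        - ∑ i : Fin N, fderiv ℝ (fun y => fderiv ℝ (u t) y (EuclideanSpace.single i 1)) x
            (EuclideanSpace.single i 1)
        = ‖x‖ ^ α * |u t x| ^ p + zeta σ m t * w x) ∧
  LocallyIntegrableOn (fun q : ℝ × EuclideanSpace ℝ (Fin N) => ‖q.2‖ ^ α * |u q.1 q.2| ^ p)
      (Set.Ici 0 ×ˢ Set.univ) ∧
  LocallyIntegrable (fun x : EuclideanSpace ℝ (Fin N) => ‖x‖ ^ (-(α / (p - 1))))

open scoped Topology ContDiff

theorem ContinuousOn.continuous_mul_of_tsupport_subset {E : Type*} [TopologicalSpace E] {s : Set E} (hs : IsOpen s)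
    {f g : E → ℝ} (hf : ContinuousOn f s) (hg : Continuous g) (hgs : tsupport g ⊆ s) :
    Continuous (fun x => f x * g x) :=
  (hf.mul hg.continuousOn).continuous_of_tsupport_subset hs
    ((tsupport_mul_subset_right (f := f) (g := g)).trans hgs)

theorem ContinuousOn.integrable_mul_of_tsupport_subset {E : Type*} [TopologicalSpace E]
    [R1Space E] [MeasurableSpace E] [OpensMeasurableSpace E]
    {μ : Measure E} [IsFiniteMeasureOnCompacts μ] {s : Set E} (hs : IsOpen s)
    {f g : E → ℝ} (hf : ContinuousOn f s) (hg : Continuous g) (hgc : HasCompactSupport g)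
    (hgs : tsupport g ⊆ s) : Integrable (fun x => f x * g x) μ :=
  (hf.continuous_mul_of_tsupport_subset hs hg hgs).integrable_of_hasCompactSupport
    (HasCompactSupport.mul_left (f := f) hgc)

section DirectionalDerivatives

variable {E : Type*} [NormedAddCommGroup E] [NormedSpace ℝ E]

/-- The second derivative of `f` at `x` in the direction `e`. -/
noncomputable def secondDirDeriv (f : E → ℝ) (e x : E) : ℝ :=
  fderiv ℝ (fun y => fderiv ℝ f y e) x e

theorem secondDirDeriv_eq_zero {f : E → ℝ} {x : E} {c : ℝ} (h : f =ᶠ[𝓝 x] fun _ => c)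
    (e : E) : secondDirDeriv f e x = 0 := by
  have : (fun y => fderiv ℝ f y e) =ᶠ[𝓝 x] fun _ => 0 := by
    filter_upwards [h.eventually_nhds] with y hy
    rw [Filter.EventuallyEq.fderiv_eq hy]
    simp
  rw [secondDirDeriv, this.fderiv_eq]
  simp

theorem contDiff_fderiv_dir {f : E → ℝ} (hf : ContDiff ℝ 2 f) (e : E) :
    ContDiff ℝ 1 (fun y => fderiv ℝ f y e) :=
  (hf.fderiv_right (m := 1) (by norm_num)).clm_apply contDiff_const

theorem contDiffOn_fderiv_dir {s : Set E} (hs : IsOpen s) {f : E → ℝ}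
    (hf : ContDiffOn ℝ 2 f s) (e : E) : ContDiffOn ℝ 1 (fun y => fderiv ℝ f y e) s :=
  (hf.fderiv_of_isOpen hs (m := 1) (by norm_num)).clm_apply contDiffOn_const

theorem continuous_secondDirDeriv {f : E → ℝ} (hf : ContDiff ℝ 2 f) (e : E) :
    Continuous (secondDirDeriv f e) :=
  ((contDiff_fderiv_dir hf e).continuous_fderiv one_ne_zero).clm_apply continuous_const

theorem continuousOn_secondDirDeriv {s : Set E} (hs : IsOpen s) {f : E → ℝ}
    (hf : ContDiffOn ℝ 2 f s) (e : E) : ContinuousOn (secondDirDeriv f e) s :=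
  ((contDiffOn_fderiv_dir hs hf e).continuousOn_fderiv_of_isOpen hs (by norm_num)).clm_apply
    continuousOn_const

theorem tsupport_secondDirDeriv_subset (f : E → ℝ) (e : E) :
    tsupport (secondDirDeriv f e) ⊆ tsupport f :=
  (tsupport_fderiv_apply_subset ℝ e).trans (tsupport_fderiv_apply_subset ℝ e)

theorem secondDirDeriv_sub {f g : E → ℝ} (hf : ContDiff ℝ 2 f) (hg : ContDiff ℝ 2 g) (e x : E) :
    secondDirDeriv (fun y => f y - g y) e x = secondDirDeriv f e x - secondDirDeriv g e x := by
  have h : (fun y => fderiv ℝ (fun y => f y - g y) y e)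
      = fun y => fderiv ℝ f y e - fderiv ℝ g y e := by
    ext y
    rw [fderiv_fun_sub (hf.differentiable two_ne_zero y) (hg.differentiable two_ne_zero y)]
    rfl
  rw [secondDirDeriv, h, fderiv_fun_sub ((contDiff_fderiv_dir hf e).differentiable one_ne_zero x)
    ((contDiff_fderiv_dir hg e).differentiable one_ne_zero x)]
  rfl

theorem secondDirDeriv_comp_smul (f : E → ℝ) (c : ℝ) (e x : E) :
    secondDirDeriv (fun y => f (c • y)) e x = c ^ 2 * secondDirDeriv f e (c • x) := by
  have h : (fun y => fderiv ℝ (fun y => f (c • y)) y e)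
      = c • fun y => (fun z => fderiv ℝ f z e) (c • y) := by
    ext y
    rw [fderiv_comp_smul]
    rfl
  rw [secondDirDeriv, h, fderiv_const_smul_field, Pi.smul_apply,
    fderiv_comp_smul (f := fun z => fderiv ℝ f z e)]
  simp [secondDirDeriv]
  ring

theorem secondDirDeriv_pow {f : E → ℝ} (hf : ContDiff ℝ 2 f) (n : ℕ) (e x : E) :
    secondDirDeriv (fun y => f y ^ (n + 2)) e x
      = f x ^ n * ((n + 2) * (n + 1) * fderiv ℝ f x e ^ 2
        + (n + 2) * (f x * secondDirDeriv f e x)) := by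
  have hd : Differentiable ℝ f := hf.differentiable two_ne_zero
  have h : (fun y => fderiv ℝ (fun y => f y ^ (n + 2)) y e)
      = fun y => ((n + 2 : ℕ) * f y ^ (n + 1)) * fderiv ℝ f y e := by
    ext y
    rw [((hd y).hasFDerivAt.pow (n + 2)).fderiv]
    simp
  have hx := ((((hd x).hasFDerivAt.pow (n + 1)).const_mul ((n + 2 : ℕ) : ℝ)).mul
    ((contDiff_fderiv_dir hf e).differentiable one_ne_zero x).hasFDerivAt).fderiv
  rw [secondDirDeriv, h]
  refine (congrArg (fun L : E →L[ℝ] ℝ => L e) hx).trans ?_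
  simp [secondDirDeriv]
  ring

theorem integral_secondDirDeriv_mul [FiniteDimensional ℝ E] [MeasurableSpace E] [BorelSpace E]
    {μ : Measure E} [μ.IsAddHaarMeasure] {s : Set E} (hs : IsOpen s) {f g : E → ℝ}
    (hf : ContDiffOn ℝ 2 f s) (hg : ContDiff ℝ 2 g) (hgc : HasCompactSupport g)
    (hgs : tsupport g ⊆ s) (e : E) :
    ∫ x, secondDirDeriv f e x * g x ∂μ = ∫ x, f x * secondDirDeriv g e x ∂μ := by
  have hg1 := contDiff_fderiv_dir hg e
  have hf1 := contDiffOn_fderiv_dir hs hf e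
  have hsub1 : tsupport (fun y => fderiv ℝ g y e) ⊆ s :=
    (tsupport_fderiv_apply_subset ℝ e).trans hgs
  have hc1 : HasCompactSupport (fun y => fderiv ℝ g y e) := hgc.fderiv_apply ℝ e
  have hsub2 := (tsupport_secondDirDeriv_subset g e).trans hgs
  have hc2 : HasCompactSupport (secondDirDeriv g e) := hc1.fderiv_apply ℝ e
  have hi : Integrable (fun x => fderiv ℝ f x e * fderiv ℝ g x e) μ :=
    hf1.continuousOn.integrable_mul_of_tsupport_subset hs hg1.continuous hc1 hsub1
  have h1 := integral_mul_fderiv_eq_neg_fderiv_mul_of_integrable (μ := μ) (v := e)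
    (f := fun y => fderiv ℝ f y e) (g := g)
    ((continuousOn_secondDirDeriv hs hf e).integrable_mul_of_tsupport_subset hs
      hg.continuous hgc hgs) hi
    (hf1.continuousOn.integrable_mul_of_tsupport_subset hs hg.continuous hgc hgs)
    (fun x hx => (hf1.differentiableOn one_ne_zero).differentiableAt (hs.mem_nhds (hgs hx)))
    (fun x _ => hg.differentiable two_ne_zero x)
  have h2 := integral_mul_fderiv_eq_neg_fderiv_mul_of_integrable (μ := μ) (v := e)
    (f := f) (g := fun y => fderiv ℝ g y e) hi
    (hf.continuousOn.integrable_mul_of_tsupport_subset hs (continuous_secondDirDeriv hg e)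
      hc2 hsub2)
    (hf.continuousOn.integrable_mul_of_tsupport_subset hs hg1.continuous hc1 hsub1)
    (fun x hx => (hf.differentiableOn two_ne_zero).differentiableAt (hs.mem_nhds (hsub1 hx)))
    (fun x _ => hg1.differentiable one_ne_zero x)
  simp only [secondDirDeriv]
  rw [h2, h1, neg_neg]

end DirectionalDerivatives

theorem mul_le_mul_rpow_add {p a A C : ℝ} (hp : 1 < p) (ha : 0 ≤ a) (hA : 0 < A) (hC : 0 ≤ C) :
    C * a ≤ A * a ^ p + C ^ (p / (p - 1)) * A ^ (-(1 / (p - 1))) := by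
  have hp0 : 0 < p - 1 := by linarith
  have hr : 0 ≤ C ^ (p / (p - 1)) * A ^ (-(1 / (p - 1))) := by positivity
  rcases ha.eq_or_lt with rfl | ha
  · rw [zero_rpow (by linarith)]
    linarith
  have hap : a ^ p = a ^ (p - 1) * a := by
    rw [← rpow_add_one ha.ne']
    congr 1
    ring
  rcases le_or_gt C (A * a ^ (p - 1)) with h | h
  · have := mul_le_mul_of_nonneg_right h ha.le
    rw [hap]
    linarith
  · have hC' : 0 < C := lt_of_le_of_lt (by positivity) h
    have h1 : a ^ (p - 1) ≤ C / A := by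
      rw [le_div_iff₀ hA]
      linarith
    have h2 : a ≤ (C / A) ^ (1 / (p - 1)) := by
      calc a = (a ^ (p - 1)) ^ (1 / (p - 1)) := by
            rw [← rpow_mul ha.le, mul_one_div_cancel hp0.ne', rpow_one]
        _ ≤ _ := by gcongr
    have h3 : C * (C / A) ^ (1 / (p - 1)) = C ^ (p / (p - 1)) * A ^ (-(1 / (p - 1))) := by
      rw [div_rpow hC'.le hA.le, rpow_neg hA.le, div_eq_mul_inv, ← mul_assoc]
      congr 1
      rw [← rpow_one_add' hC'.le (by positivity)]
      congr 1
      field_simp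
      ring
    have h4 := mul_le_mul_of_nonneg_left h2 hC
    have h5 : 0 ≤ A * a ^ p := by positivity
    linarith

/-- Absorption of the linear terms of the weak formulation by the power nonlinearity. -/
theorem neg_le_absorption {p α R r v φ η η' L C₁ C₂ : ℝ} (hp : 1 < p) (hR : 0 < R) (hr : 0 < r)
    (hφ0 : 0 ≤ φ) (hφ1 : φ ≤ 1) (hη0 : 0 ≤ η) (hη1 : η ≤ 1) (hC₁ : 0 ≤ C₁) (hC₂ : 0 ≤ C₂)
    (hL : |L| ≤ (R⁻¹) ^ 2 * (C₁ * φ ^ (1 / p))) (hη' : |η'| ≤ C₂ * η ^ (1 / p)) :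
    -((C₁ + C₂) ^ (p / (p - 1)) * (R ^ 2 * r ^ α) ^ (-(1 / (p - 1))))
      ≤ R ^ 2 * (v * L) * η + v * φ * η' + R ^ 2 * (r ^ α * |v| ^ p * φ) * η := by
  have hp0 : 0 < p := by linarith
  have hle : ∀ x : ℝ, 0 ≤ x → x ≤ 1 → x ≤ x ^ (1 / p) := fun x h0 h1 =>
    self_le_rpow_of_le_one h0 h1 (by rw [div_le_one hp0]; exact hp.le)
  have hy := mul_le_mul_rpow_add (p := p) (a := |v| * (φ ^ (1 / p) * η ^ (1 / p)))
    (A := R ^ 2 * r ^ α) (C := C₁ + C₂) hp (by positivity) (by positivity) (by positivity)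
  have hpow : (|v| * (φ ^ (1 / p) * η ^ (1 / p))) ^ p = |v| ^ p * (φ * η) := by
    rw [mul_rpow (by positivity) (by positivity), mul_rpow (by positivity) (by positivity),
      ← rpow_mul hφ0, ← rpow_mul hη0, one_div_mul_cancel hp0.ne', rpow_one, rpow_one]
  rw [hpow] at hy
  have h1 : |R ^ 2 * (v * L) * η| ≤ C₁ * (|v| * (φ ^ (1 / p) * η ^ (1 / p))) := by
    rw [abs_mul, abs_mul, abs_mul, abs_of_nonneg hη0, abs_of_nonneg (sq_nonneg R)]
    calc R ^ 2 * (|v| * |L|) * η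
        ≤ R ^ 2 * (|v| * ((R⁻¹) ^ 2 * (C₁ * φ ^ (1 / p)))) * η ^ (1 / p) := by
          gcongr
          exact hle η hη0 hη1
      _ = _ := by
          field_simp
  have h2 : |v * φ * η'| ≤ C₂ * (|v| * (φ ^ (1 / p) * η ^ (1 / p))) := by
    rw [abs_mul, abs_mul, abs_of_nonneg hφ0]
    calc |v| * φ * |η'| ≤ |v| * φ ^ (1 / p) * (C₂ * η ^ (1 / p)) := by
          gcongr
          exact hle φ hφ0 hφ1
      _ = _ := by ring
  have h1' := neg_le_of_abs_le h1
  have h2' := neg_le_of_abs_le h2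
  nlinarith

/-- The Laplacian on `ℝ^N`, as the sum of the second coordinate derivatives. -/
noncomputable def coordLaplacian {N : ℕ} (f : EuclideanSpace ℝ (Fin N) → ℝ)
    (x : EuclideanSpace ℝ (Fin N)) : ℝ :=
  ∑ i, secondDirDeriv f (EuclideanSpace.single i 1) x

/-- A `C^2` cutoff of the ball of radius `1`, supported in the ball of radius `2`, whose Laplacian
is controlled by its power `1 / p`. -/
structure IsTestProfile {N : ℕ} (p C : ℝ) (ψ : EuclideanSpace ℝ (Fin N) → ℝ) : Prop where
  contDiff : ContDiff ℝ 2 ψ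
  nonneg : ∀ x, 0 ≤ ψ x
  le_one : ∀ x, ψ x ≤ 1
  eq_one : ∀ x, ‖x‖ ≤ 1 → ψ x = 1
  eq_zero : ∀ x, 2 ≤ ‖x‖ → ψ x = 0
  const_nonneg : 0 ≤ C
  abs_laplacian_le : ∀ x, |coordLaplacian ψ x| ≤ C * ψ x ^ (1 / p)

theorem exists_isTestProfile (N : ℕ) {p : ℝ} (hp : 1 < p) :
    ∃ (C : ℝ) (ψ : EuclideanSpace ℝ (Fin N) → ℝ), IsTestProfile p C ψ := by
  let f : ContDiffBump (0 : EuclideanSpace ℝ (Fin N)) := ⟨1, 2, one_pos, one_lt_two⟩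
  have hf : ContDiff ℝ 2 f := f.contDiff
  obtain ⟨n, hn⟩ := exists_nat_ge (2 / (p - 1))
  have hp0 : 0 < p - 1 := by linarith
  have hn' : ((n + 2 : ℕ) : ℝ) * (1 / p) ≤ n := by
    rw [div_le_iff₀ hp0] at hn
    rw [mul_one_div, div_le_iff₀ (by linarith)]
    push_cast
    nlinarith
  let g : EuclideanSpace ℝ (Fin N) → ℝ := fun x =>
    ∑ i : Fin N, (((n : ℝ) + 2) * (n + 1) * fderiv ℝ f x (EuclideanSpace.single i 1) ^ 2
        + (n + 2) * (f x * secondDirDeriv f (EuclideanSpace.single i 1) x))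
  have hg : ∀ x, coordLaplacian (fun y => f y ^ (n + 2)) x = f x ^ n * g x := by
    intro x
    simp only [coordLaplacian, g, Finset.mul_sum]
    exact Finset.sum_congr rfl fun i _ => secondDirDeriv_pow hf n _ x
  have hgc : Continuous g := by
    refine continuous_finsetSum _ fun i _ => ?_
    have h1 := (contDiff_fderiv_dir hf (EuclideanSpace.single i 1)).continuous
    have h2 := continuous_secondDirDeriv hf (EuclideanSpace.single i 1)
    have h3 := f.continuous
    fun_prop
  obtain ⟨C, hC⟩ := (isCompact_closedBall (0 : EuclideanSpace ℝ (Fin N)) 2).exists_bound_of_continuousOn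
    hgc.continuousOn
  have hzero : ∀ x : EuclideanSpace ℝ (Fin N), 2 ≤ ‖x‖ → f x = 0 := fun x hx =>
    f.zero_of_le_dist (by simpa [f] using hx)
  have hnear : ∀ x : EuclideanSpace ℝ (Fin N), 2 < ‖x‖ → g x = 0 := by
    intro x hx
    have hev : (f : EuclideanSpace ℝ (Fin N) → ℝ) =ᶠ[𝓝 x] fun _ => 0 := by
      filter_upwards [(isOpen_lt continuous_const continuous_norm).mem_nhds hx] with y hy
      exact hzero y (le_of_lt hy)
    refine Finset.sum_eq_zero fun i _ => ?_
    rw [secondDirDeriv_eq_zero hev, hev.fderiv_eq]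
    simp
  have hgb : ∀ x, |g x| ≤ max C 0 := by
    intro x
    rcases le_or_gt ‖x‖ 2 with h | h
    · exact (hC x (by simpa using h)).trans (le_max_left _ _)
    · simp [hnear x h]
  refine ⟨max C 0, fun x => f x ^ (n + 2), hf.pow _, fun x => pow_nonneg f.nonneg _,
    fun x => pow_le_one₀ f.nonneg f.le_one, fun x hx => ?_, fun x hx => ?_, le_max_right _ _,
    fun x => ?_⟩
  · rw [f.one_of_mem_closedBall (by simpa [f] using hx), one_pow]
  · rw [hzero x hx, zero_pow (by omega)]
  · rw [hg, abs_mul, abs_of_nonneg (pow_nonneg f.nonneg _), mul_comm]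
    have hfn : 0 ≤ f x := f.nonneg
    refine mul_le_mul (hgb x) ?_ (pow_nonneg f.nonneg _) (le_max_right _ _)
    rw [← rpow_natCast, ← rpow_natCast, ← rpow_mul f.nonneg]
    rcases hfn.eq_or_lt with h0 | h0
    · rw [← h0, zero_rpow, zero_rpow]
      · positivity
      · have : 0 < (n : ℝ) := lt_of_lt_of_le (by positivity) hn
        exact this.ne'
    · exact rpow_le_rpow_of_exponent_ge h0 f.le_one hn'

theorem exists_time_profile {p : ℝ} (hp : 1 < p) :
    ∃ (C : ℝ) (η η' : ℝ → ℝ), 0 ≤ C ∧ (∀ s, HasDerivAt η (η' s) s) ∧ Continuous η ∧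
      η 1 = 0 ∧ η 2 = 0 ∧ (∀ s ∈ Icc (1 : ℝ) 2, 0 ≤ η s ∧ η s ≤ 1) ∧
      (∀ s ∈ Icc (1 : ℝ) 2, |η' s| ≤ C * η s ^ (1 / p)) ∧ 0 < ∫ s in (1 : ℝ)..2, η s := by
  obtain ⟨n, hn⟩ := exists_nat_ge (1 / (p - 1))
  have hp0 : 0 < p - 1 := by linarith
  have hn' : ((n + 1 : ℕ) : ℝ) * (1 / p) ≤ n := by
    rw [div_le_iff₀ hp0] at hn
    rw [mul_one_div, div_le_iff₀ (by linarith)]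
    push_cast
    nlinarith
  have hnpos : 0 < (n : ℝ) := lt_of_lt_of_le (by positivity) hn
  have hcont : Continuous fun s : ℝ => ((s - 1) * (2 - s)) ^ (n + 1) := by fun_prop
  have hb : ∀ s ∈ Icc (1 : ℝ) 2, 0 ≤ (s - 1) * (2 - s) ∧ (s - 1) * (2 - s) ≤ 1 := fun s hs =>
    ⟨mul_nonneg (by linarith [hs.1]) (by linarith [hs.2]), by nlinarith [hs.1, hs.2]⟩
  refine ⟨n + 1, fun s => ((s - 1) * (2 - s)) ^ (n + 1),
    fun s => (n + 1) * ((s - 1) * (2 - s)) ^ n * (3 - 2 * s), by positivity, fun s => ?_, hcont,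
    by simp, by simp, fun s hs => ⟨pow_nonneg (hb s hs).1 _, pow_le_one₀ (hb s hs).1 (hb s hs).2⟩,
    fun s hs => ?_, ?_⟩
  · have h := (((hasDerivAt_id s).sub_const 1).mul ((hasDerivAt_id s).const_sub 2)).pow (n + 1)
    convert! h using 1
    simp
    left
    ring
  · obtain ⟨h0, h1⟩ := hb s hs
    have h3 : |3 - 2 * s| ≤ 1 := by
      rw [abs_le]
      constructor <;> linarith [hs.1, hs.2]
    have h4 : ((s - 1) * (2 - s)) ^ n ≤ (((s - 1) * (2 - s)) ^ (n + 1)) ^ (1 / p) := by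
      rw [← rpow_natCast, ← rpow_natCast, ← rpow_mul h0]
      rcases h0.eq_or_lt with h | h
      · rw [← h, zero_rpow hnpos.ne', zero_rpow (by positivity)]
      · exact rpow_le_rpow_of_exponent_ge h h1 hn'
    rw [abs_mul, abs_mul, abs_of_nonneg (pow_nonneg h0 n), abs_of_nonneg (by positivity)]
    calc _ ≤ ((n : ℝ) + 1) * (((s - 1) * (2 - s)) ^ (n + 1)) ^ (1 / p) * 1 := by gcongr
      _ = _ := mul_one _
  · refine intervalIntegral.intervalIntegral_pos_of_pos_on (hcont.intervalIntegrable _ _)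
      (fun s hs => ?_) one_lt_two
    exact pow_pos (mul_pos (by linarith [hs.1]) (by linarith [hs.2])) _

theorem coordLaplacian_comp_smul {N : ℕ} (f : EuclideanSpace ℝ (Fin N) → ℝ) (c : ℝ)
    (x : EuclideanSpace ℝ (Fin N)) :
    coordLaplacian (fun y => f (c • y)) x = c ^ 2 * coordLaplacian f (c • x) := by
  simp only [coordLaplacian, secondDirDeriv_comp_smul, Finset.mul_sum]

theorem continuous_coordLaplacian {N : ℕ} {f : EuclideanSpace ℝ (Fin N) → ℝ}
    (hf : ContDiff ℝ 2 f) : Continuous (coordLaplacian f) :=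
  continuous_finsetSum _ fun _ _ => continuous_secondDirDeriv hf _

theorem integral_coordLaplacian_mul {N : ℕ} {s : Set (EuclideanSpace ℝ (Fin N))} (hs : IsOpen s)
    {f g : EuclideanSpace ℝ (Fin N) → ℝ} (hf : ContDiffOn ℝ 2 f s) (hg : ContDiff ℝ 2 g)
    (hgc : HasCompactSupport g) (hgs : tsupport g ⊆ s) :
    ∫ x, coordLaplacian f x * g x = ∫ x, f x * coordLaplacian g x := by
  simp only [coordLaplacian, Finset.sum_mul, Finset.mul_sum]
  rw [integral_finsetSum, integral_finsetSum]
  · exact Finset.sum_congr rfl fun i _ => integral_secondDirDeriv_mul hs hf hg hgc hgs _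
  · intro i _
    refine hf.continuousOn.integrable_mul_of_tsupport_subset hs (continuous_secondDirDeriv hg _)
      ?_ ((tsupport_secondDirDeriv_subset g _).trans hgs)
    exact (hgc.fderiv_apply ℝ _).fderiv_apply ℝ _
  · intro i _
    exact (continuousOn_secondDirDeriv hs hf _).integrable_mul_of_tsupport_subset hs
      hg.continuous hgc hgs

/-- The test function that equals `1` on the annulus `2ε ≤ ‖x‖ ≤ R` and is supported in
`ε ≤ ‖x‖ ≤ 2R`. -/
noncomputable def annularCutoff {N : ℕ} (ψ : EuclideanSpace ℝ (Fin N) → ℝ) (R ε : ℝ)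
    (x : EuclideanSpace ℝ (Fin N)) : ℝ :=
  ψ (R⁻¹ • x) - ψ (ε⁻¹ • x)

theorem norm_inv_smul_le_iff {N : ℕ} {r : ℝ} (hr : 0 < r) (x : EuclideanSpace ℝ (Fin N)) (c : ℝ) :
    ‖r⁻¹ • x‖ ≤ c ↔ ‖x‖ ≤ c * r := by
  rw [norm_smul, norm_inv, Real.norm_of_nonneg hr.le, inv_mul_le_iff₀ hr, mul_comm]

theorem le_norm_inv_smul_iff {N : ℕ} {r : ℝ} (hr : 0 < r) (x : EuclideanSpace ℝ (Fin N)) (c : ℝ) :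
    c ≤ ‖r⁻¹ • x‖ ↔ c * r ≤ ‖x‖ := by
  rw [norm_smul, norm_inv, Real.norm_of_nonneg hr.le, le_inv_mul_iff₀ hr, mul_comm]

namespace IsTestProfile

variable {N : ℕ} {p C : ℝ} {ψ : EuclideanSpace ℝ (Fin N) → ℝ}

theorem laplacian_eq_zero_of_le (h : IsTestProfile p C ψ) (hp : 1 < p)
    {x : EuclideanSpace ℝ (Fin N)} (hx : 2 ≤ ‖x‖) : coordLaplacian ψ x = 0 := by
  have := h.abs_laplacian_le x
  rw [h.eq_zero x hx, zero_rpow (by positivity), mul_zero] at this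
  exact abs_nonpos_iff.1 this

theorem laplacian_eq_zero_of_lt (h : IsTestProfile p C ψ)
    {x : EuclideanSpace ℝ (Fin N)} (hx : ‖x‖ < 1) : coordLaplacian ψ x = 0 := by
  refine Finset.sum_eq_zero fun i _ => secondDirDeriv_eq_zero (c := 1) ?_ _
  filter_upwards [(isOpen_lt continuous_norm continuous_const).mem_nhds hx] with y hy
  exact h.eq_one y (le_of_lt hy)

theorem hasCompactSupport (h : IsTestProfile p C ψ) : HasCompactSupport ψ := by
  refine HasCompactSupport.intro (isCompact_closedBall 0 2) fun x hx => h.eq_zero x ?_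
  simp only [Metric.mem_closedBall, dist_zero_right, not_le] at hx
  exact hx.le

theorem hasCompactSupport_laplacian (h : IsTestProfile p C ψ) (hp : 1 < p) :
    HasCompactSupport (coordLaplacian ψ) := by
  refine HasCompactSupport.intro (isCompact_closedBall 0 2) fun x hx =>
    h.laplacian_eq_zero_of_le hp ?_
  simp only [Metric.mem_closedBall, dist_zero_right, not_le] at hx
  exact hx.le

variable {R ε : ℝ}

theorem contDiff_comp_smul (h : IsTestProfile p C ψ) (c : ℝ) :
    ContDiff ℝ 2 (fun x => ψ (c • x)) :=
  h.contDiff.comp (contDiff_const_smul c)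

theorem annularCutoff_contDiff (h : IsTestProfile p C ψ) : ContDiff ℝ 2 (annularCutoff ψ R ε) :=
  (h.contDiff_comp_smul _).sub (h.contDiff_comp_smul _)

theorem annularCutoff_eq_zero_of_lt (h : IsTestProfile p C ψ) (hε : 0 < ε) (hεR : 2 * ε ≤ R)
    {x : EuclideanSpace ℝ (Fin N)} (hx : ‖x‖ < ε) : annularCutoff ψ R ε x = 0 := by
  rw [annularCutoff, h.eq_one, h.eq_one, sub_self]
  · rw [norm_inv_smul_le_iff hε]
    linarith
  · rw [norm_inv_smul_le_iff (by linarith)]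
    linarith

theorem annularCutoff_eq_zero_of_le (h : IsTestProfile p C ψ) (hε : 0 < ε) (hεR : 2 * ε ≤ R)
    {x : EuclideanSpace ℝ (Fin N)} (hx : 2 * R ≤ ‖x‖) : annularCutoff ψ R ε x = 0 := by
  rw [annularCutoff, h.eq_zero, h.eq_zero, sub_self]
  · rw [le_norm_inv_smul_iff hε]
    linarith
  · rw [le_norm_inv_smul_iff (by linarith)]
    linarith

theorem tsupport_annularCutoff_subset (h : IsTestProfile p C ψ) (hε : 0 < ε) (hεR : 2 * ε ≤ R) :
    tsupport (annularCutoff ψ R ε) ⊆ {x | x ≠ 0} := by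
  have : tsupport (annularCutoff ψ R ε) ⊆ {x | ε ≤ ‖x‖} := by
    refine closure_minimal (fun x hx => ?_) (isClosed_le continuous_const continuous_norm)
    by_contra hlt
    exact hx (h.annularCutoff_eq_zero_of_lt hε hεR (not_le.1 hlt))
  intro x hx
  exact norm_pos_iff.1 (hε.trans_le (this hx))

theorem hasCompactSupport_annularCutoff (h : IsTestProfile p C ψ) (hε : 0 < ε)
    (hεR : 2 * ε ≤ R) : HasCompactSupport (annularCutoff ψ R ε) := by
  refine HasCompactSupport.intro (isCompact_closedBall 0 (2 * R)) fun x hx =>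
    h.annularCutoff_eq_zero_of_le hε hεR ?_
  simp only [Metric.mem_closedBall, dist_zero_right, not_le] at hx
  exact hx.le

theorem annularCutoff_eq_or (h : IsTestProfile p C ψ) (hε : 0 < ε) (hεR : 2 * ε ≤ R)
    (x : EuclideanSpace ℝ (Fin N)) :
    annularCutoff ψ R ε x = ψ (R⁻¹ • x) ∨
      (‖R⁻¹ • x‖ < 1 ∧ annularCutoff ψ R ε x = 1 - ψ (ε⁻¹ • x)) := by
  rcases le_or_gt (2 * ε) ‖x‖ with hx | hx
  · left
    rw [annularCutoff, h.eq_zero (ε⁻¹ • x), sub_zero]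
    rwa [le_norm_inv_smul_iff hε]
  · right
    have h1 : ‖R⁻¹ • x‖ < 1 := by
      rw [← not_le, le_norm_inv_smul_iff (by linarith), not_le]
      linarith
    exact ⟨h1, by rw [annularCutoff, h.eq_one _ h1.le]⟩

theorem annularCutoff_nonneg (h : IsTestProfile p C ψ) (hε : 0 < ε) (hεR : 2 * ε ≤ R)
    (x : EuclideanSpace ℝ (Fin N)) : 0 ≤ annularCutoff ψ R ε x := by
  rcases h.annularCutoff_eq_or hε hεR x with hx | ⟨-, hx⟩ <;> rw [hx]
  · exact h.nonneg _
  · linarith [h.le_one (ε⁻¹ • x)]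

theorem annularCutoff_le_one (h : IsTestProfile p C ψ) (x : EuclideanSpace ℝ (Fin N)) :
    annularCutoff ψ R ε x ≤ 1 := by
  rw [annularCutoff]
  linarith [h.le_one (R⁻¹ • x), h.nonneg (ε⁻¹ • x)]

theorem laplacian_annularCutoff (h : IsTestProfile p C ψ) (x : EuclideanSpace ℝ (Fin N)) :
    coordLaplacian (annularCutoff ψ R ε) x
      = R⁻¹ ^ 2 * coordLaplacian ψ (R⁻¹ • x) - ε⁻¹ ^ 2 * coordLaplacian ψ (ε⁻¹ • x) := by
  rw [← coordLaplacian_comp_smul, ← coordLaplacian_comp_smul, coordLaplacian, coordLaplacian,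
    coordLaplacian, ← Finset.sum_sub_distrib]
  exact Finset.sum_congr rfl fun i _ =>
    secondDirDeriv_sub (h.contDiff_comp_smul _) (h.contDiff_comp_smul _) _ _

theorem abs_laplacian_comp_smul_le (h : IsTestProfile p C ψ) (hε : 0 < ε) (hεR : 2 * ε ≤ R)
    (x : EuclideanSpace ℝ (Fin N)) :
    |R⁻¹ ^ 2 * coordLaplacian ψ (R⁻¹ • x)|
      ≤ R⁻¹ ^ 2 * (C * annularCutoff ψ R ε x ^ (1 / p)) := by
  rw [abs_mul, abs_of_nonneg (sq_nonneg _)]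
  refine mul_le_mul_of_nonneg_left ?_ (sq_nonneg _)
  rcases h.annularCutoff_eq_or hε hεR x with hx | ⟨hx, -⟩
  · rw [hx]
    exact h.abs_laplacian_le _
  · rw [h.laplacian_eq_zero_of_lt hx, abs_zero]
    exact mul_nonneg h.const_nonneg (rpow_nonneg (h.annularCutoff_nonneg hε hεR x) _)

end IsTestProfile

/-- The spatial lower bound: the nonlinearity absorbs all contributions of the test function but
the weight integral over the ball of radius `2R` and an error concentrated near the origin. -/
theorem IsTestProfile.spatial_lower_bound {N : ℕ} {α p C₁ C₂ : ℝ}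
    {ψ : EuclideanSpace ℝ (Fin N) → ℝ} (h : IsTestProfile p C₁ ψ) (hp : 1 < p) (hC₂ : 0 ≤ C₂)
    (hN : 2 ≤ N)
    (hw : LocallyIntegrable (fun x : EuclideanSpace ℝ (Fin N) => ‖x‖ ^ (-(α / (p - 1)))))
    {R ε M η η' : ℝ} (hε : 0 < ε) (hε1 : ε ≤ 1) (hεR : 2 * ε ≤ R)
    {v : EuclideanSpace ℝ (Fin N) → ℝ} (hv : Continuous v) (hM : ∀ x, ‖x‖ ≤ 2 → |v x| ≤ M)
    (hη0 : 0 ≤ η) (hη1 : η ≤ 1) (hη' : |η'| ≤ C₂ * η ^ (1 / p)) :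
    -((C₁ + C₂) ^ (p / (p - 1)) * R ^ ((N : ℝ) - (α + 2) / (p - 1))
        * ∫ x : EuclideanSpace ℝ (Fin N) in Metric.ball 0 2, ‖x‖ ^ (-(α / (p - 1))))
      - R ^ 2 * M * ε ^ (N - 2) * ∫ x, |coordLaplacian ψ x|
      ≤ R ^ 2 * ((∫ x, v x * coordLaplacian (annularCutoff ψ R ε) x)
          + ∫ x, ‖x‖ ^ α * |v x| ^ p * annularCutoff ψ R ε x) * η
        + (∫ x, v x * annularCutoff ψ R ε x) * η' := by
  have hR : 0 < R := by linarith
  have hp0 : 0 < p - 1 := by linarith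
  have : Nontrivial (EuclideanSpace ℝ (Fin N)) := by
    have : Nonempty (Fin N) := ⟨⟨0, by omega⟩⟩
    infer_instance
  have hopen : IsOpen {x : EuclideanSpace ℝ (Fin N) | x ≠ 0} := isOpen_ne
  have hcomp := h.hasCompactSupport_annularCutoff hε hεR
  have hsub := h.tsupport_annularCutoff_subset hε hεR
  have hΦ : ContDiff ℝ 2 (annularCutoff ψ R ε) := h.annularCutoff_contDiff
  set γ := α / (p - 1) with hγ
  set W : EuclideanSpace ℝ (Fin N) → ℝ :=
    (Metric.ball (0 : EuclideanSpace ℝ (Fin N)) 2).indicator (fun x => ‖x‖ ^ (-γ)) with hW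
  have hWint : Integrable W := by
    rw [hW, integrable_indicator_iff Metric.isOpen_ball.measurableSet]
    exact (hw.integrableOn_isCompact (isCompact_closedBall 0 2)).mono_set Metric.ball_subset_closedBall
  have hW0 : ∀ x, 0 ≤ W x := fun x => indicator_nonneg (fun y _ => by positivity) x
  have hLc : Continuous (coordLaplacian ψ) := continuous_coordLaplacian h.contDiff
  have hLint : Integrable (fun x => |coordLaplacian ψ x|) :=
    (hLc.integrable_of_hasCompactSupport (h.hasCompactSupport_laplacian hp)).abs
  set K := (C₁ + C₂) ^ (p / (p - 1)) with hK
  have hK0 : 0 ≤ K := rpow_nonneg (add_nonneg h.const_nonneg hC₂) _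
  have i1 : Integrable (fun x => v x * coordLaplacian (annularCutoff ψ R ε) x) := by
    refine hv.continuousOn.integrable_mul_of_tsupport_subset isOpen_univ
      (continuous_coordLaplacian hΦ) ?_ (subset_univ _)
    refine hcomp.mono' (fun x hx => ?_)
    by_contra hx'
    refine hx (Finset.sum_eq_zero fun i _ => ?_)
    exact secondDirDeriv_eq_zero (notMem_tsupport_iff_eventuallyEq.1 hx') _
  have hFc : ContinuousOn (fun x => ‖x‖ ^ α * |v x| ^ p) {x | x ≠ 0} := by
    refine (continuous_norm.continuousOn.rpow_const fun x hx => Or.inl (norm_ne_zero_iff.2 hx)).mul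
      ?_
    exact (hv.abs.rpow_const fun x => Or.inr (by linarith)).continuousOn
  have i2 : Integrable (fun x => ‖x‖ ^ α * |v x| ^ p * annularCutoff ψ R ε x) :=
    hFc.integrable_mul_of_tsupport_subset hopen hΦ.continuous hcomp hsub
  have i3 : Integrable (fun x => v x * annularCutoff ψ R ε x) :=
    hv.continuousOn.integrable_mul_of_tsupport_subset isOpen_univ hΦ.continuous hcomp
      (subset_univ _)
  have iW : Integrable (fun x => W (R⁻¹ • x)) := hWint.comp_smul (inv_ne_zero hR.ne')
  have iL : Integrable (fun x => |coordLaplacian ψ (ε⁻¹ • x)|) :=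
    hLint.comp_smul (inv_ne_zero hε.ne')
  have i4 : Integrable
      (fun x => -(K * (R ^ (-(2 / (p - 1))) * R ^ (-γ)) * W (R⁻¹ • x))) :=
    (iW.const_mul _).neg
  have i5 : Integrable (fun x => R ^ 2 * (v x * coordLaplacian (annularCutoff ψ R ε) x
      + ‖x‖ ^ α * |v x| ^ p * annularCutoff ψ R ε x) * η) :=
    ((i1.add i2).const_mul _).mul_const _
  have key : ∫ x, (-(K * (R ^ (-(2 / (p - 1))) * R ^ (-γ)) * W (R⁻¹ • x))
        - R ^ 2 * M * ε⁻¹ ^ 2 * |coordLaplacian ψ (ε⁻¹ • x)|)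
      ≤ ∫ x, ((R ^ 2 * (v x * coordLaplacian (annularCutoff ψ R ε) x
          + ‖x‖ ^ α * |v x| ^ p * annularCutoff ψ R ε x)) * η
          + v x * annularCutoff ψ R ε x * η') := by
    refine integral_mono_ae (i4.sub (iL.const_mul _))
      (i5.add (i3.mul_const _)) ?_
    have hne : ∀ᵐ x : EuclideanSpace ℝ (Fin N), x ≠ 0 := by
      simp [ae_iff, measure_singleton]
    filter_upwards [hne] with x hx
    have hxpos : 0 < ‖x‖ := norm_pos_iff.2 hx
    have herr : R ^ 2 * (v x * (ε⁻¹ ^ 2 * coordLaplacian ψ (ε⁻¹ • x))) * η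
        ≤ R ^ 2 * M * ε⁻¹ ^ 2 * |coordLaplacian ψ (ε⁻¹ • x)| := by
      rcases le_or_gt ‖x‖ 2 with hx2 | hx2
      · have hvL : v x * coordLaplacian ψ (ε⁻¹ • x) ≤ M * |coordLaplacian ψ (ε⁻¹ • x)| := by
          refine (le_abs_self _).trans ?_
          rw [abs_mul]
          exact mul_le_mul_of_nonneg_right (hM x hx2) (abs_nonneg _)
        have hM0 : 0 ≤ M := (abs_nonneg _).trans (hM x hx2)
        calc _ = R ^ 2 * ε⁻¹ ^ 2 * ((v x * coordLaplacian ψ (ε⁻¹ • x)) * η) := by ring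
          _ ≤ R ^ 2 * ε⁻¹ ^ 2 * ((M * |coordLaplacian ψ (ε⁻¹ • x)|) * 1) := by
            refine mul_le_mul_of_nonneg_left ?_ (by positivity)
            exact (mul_le_mul_of_nonneg_right hvL hη0).trans
              (mul_le_mul_of_nonneg_left hη1 (by positivity))
          _ = _ := by ring
      · rw [h.laplacian_eq_zero_of_le hp]
        · simp
        · rw [le_norm_inv_smul_iff hε]
          linarith
    have hmain : -(K * (R ^ (-(2 / (p - 1))) * R ^ (-γ)) * W (R⁻¹ • x))
        ≤ R ^ 2 * (v x * (R⁻¹ ^ 2 * coordLaplacian ψ (R⁻¹ • x))) * η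
          + v x * annularCutoff ψ R ε x * η'
          + R ^ 2 * (‖x‖ ^ α * |v x| ^ p * annularCutoff ψ R ε x) * η := by
      rcases lt_or_ge ‖x‖ (2 * R) with hx2 | hx2
      · have habs := neg_le_absorption (α := α) (v := v x) hp hR hxpos
          (h.annularCutoff_nonneg hε hεR x) (h.annularCutoff_le_one x) hη0 hη1 h.const_nonneg hC₂
          (h.abs_laplacian_comp_smul_le hε hεR x) hη'
        refine le_trans (le_of_eq ?_) habs
        have hmem : R⁻¹ • x ∈ Metric.ball (0 : EuclideanSpace ℝ (Fin N)) 2 := by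
          rw [mem_ball_zero_iff, ← not_le, le_norm_inv_smul_iff hR]
          exact not_le.2 hx2
        rw [hW, indicator_of_mem hmem, norm_smul, norm_inv, Real.norm_of_nonneg hR.le,
          mul_rpow (by positivity) hxpos.le, mul_rpow (by positivity) (by positivity),
          inv_rpow hR.le, ← rpow_mul hxpos.le, ← rpow_natCast, ← rpow_mul hR.le]
        have e1 : α * -(1 / (p - 1)) = -γ := by rw [hγ]; ring
        have e2 : ((2 : ℕ) : ℝ) * -(1 / (p - 1)) = -(2 / (p - 1)) := by push_cast; ring
        rw [e1, e2]
        have := (rpow_pos_of_pos hR (-γ)).ne'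
        field_simp
        rw [hK]
      · rw [h.annularCutoff_eq_zero_of_le hε hεR hx2, h.laplacian_eq_zero_of_le hp]
        · have := hW0 (R⁻¹ • x)
          have : 0 ≤ K * (R ^ (-(2 / (p - 1))) * R ^ (-γ)) * W (R⁻¹ • x) := by positivity
          simpa using this
        · rwa [le_norm_inv_smul_iff hR]
    rw [h.laplacian_annularCutoff]
    linarith
  rw [integral_sub i4 (iL.const_mul _), integral_neg, integral_const_mul,
    integral_const_mul, integral_add i5 (i3.mul_const _),
    integral_mul_const, integral_mul_const, integral_const_mul, integral_add i1 i2,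
    Measure.integral_comp_inv_smul_of_nonneg volume W hR.le,
    Measure.integral_comp_inv_smul_of_nonneg volume (fun x => |coordLaplacian ψ x|) hε.le,
    hW, integral_indicator Metric.isOpen_ball.measurableSet, finrank_euclideanSpace_fin] at key
  refine le_trans (le_of_eq ?_) key
  have e1 : R ^ ((N : ℝ) - (α + 2) / (p - 1)) = R ^ (-(2 / (p - 1))) * R ^ (-γ) * R ^ N := by
    rw [← rpow_natCast R N, ← rpow_add hR, ← rpow_add hR]
    congr 1
    rw [hγ]
    ring
  have e2 : ε ^ (N - 2) = ε⁻¹ ^ 2 * ε ^ N := by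
    obtain ⟨k, rfl⟩ := Nat.exists_eq_add_of_le hN
    rw [Nat.add_sub_cancel_left, pow_add]
    field_simp
  rw [e1, e2]
  simp only [smul_eq_mul]
  ring

theorem hasDerivAt_integral_mul {E : Type*} [TopologicalSpace E] [R1Space E]
    [SecondCountableTopology E] [MeasurableSpace E] [BorelSpace E] {μ : Measure E}
    [IsFiniteMeasureOnCompacts μ] {s : Set E} (hs : IsOpen s) {u : ℝ → E → ℝ}
    (hu : ∀ t, 0 < t → ContinuousOn (u t) s)
    (hd : ∀ t, 0 < t → ∀ x ∈ s, DifferentiableAt ℝ (fun τ => u τ x) t)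
    (hdc : ContinuousOn (fun q : ℝ × E => deriv (fun τ => u τ q.2) q.1) (Ioi 0 ×ˢ s))
    {g : E → ℝ} (hg : Continuous g) (hgc : HasCompactSupport g) (hgs : tsupport g ⊆ s)
    {t : ℝ} (ht : 0 < t) :
    HasDerivAt (fun τ => ∫ x, u τ x * g x ∂μ) (∫ x, deriv (fun τ => u τ x) t * g x ∂μ) t := by
  have hK : IsCompact (Icc (t / 2) (2 * t) ×ˢ tsupport g) := isCompact_Icc.prod hgc
  have hsub : Icc (t / 2) (2 * t) ×ˢ tsupport g ⊆ Ioi 0 ×ˢ s := fun q hq =>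
    ⟨lt_of_lt_of_le (by positivity : 0 < t / 2) hq.1.1, hgs hq.2⟩
  obtain ⟨C, hC⟩ := hK.exists_bound_of_continuousOn (hdc.mono hsub)
  have hdt : ContinuousOn (fun x => deriv (fun τ => u τ x) t) s :=
    hdc.comp (f := fun x => (t, x)) (by fun_prop) fun x hx => ⟨ht, hx⟩
  refine (hasDerivAt_integral_of_dominated_loc_of_deriv_le (s := Icc (t / 2) (2 * t))
    (F := fun τ x => u τ x * g x) (F' := fun τ x => deriv (fun τ => u τ x) τ * g x)
    (bound := fun x => C * |g x|) (Icc_mem_nhds (by linarith) (by linarith)) ?_ ?_ ?_ ?_ ?_ ?_).2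
  · filter_upwards [lt_mem_nhds ht] with τ hτ
    exact ((hu τ hτ).continuous_mul_of_tsupport_subset hs hg hgs).aestronglyMeasurable
  · exact (hu t ht).integrable_mul_of_tsupport_subset hs hg hgc hgs
  · exact (hdt.continuous_mul_of_tsupport_subset hs hg hgs).aestronglyMeasurable
  · refine Eventually.of_forall fun x τ hτ => ?_
    rw [norm_mul]
    by_cases hx : x ∈ tsupport g
    · exact mul_le_mul_of_nonneg_right (hC (τ, x) ⟨hτ, hx⟩) (norm_nonneg _)
    · simp [image_eq_zero_of_notMem_tsupport hx]
  · exact ((hg.integrable_of_hasCompactSupport hgc).abs).const_mul _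
  · refine Eventually.of_forall fun x τ hτ => ?_
    by_cases hx : x ∈ tsupport g
    · exact (hd τ (lt_of_lt_of_le (by positivity) hτ.1) x (hgs hx)).hasDerivAt.mul_const _
    · simpa [image_eq_zero_of_notMem_tsupport hx] using hasDerivAt_const τ (0 : ℝ)

namespace IsGlobalClassicalSolution

variable {N : ℕ} {α p σ m : ℝ} {w : EuclideanSpace ℝ (Fin N) → ℝ}
  {u : ℝ → EuclideanSpace ℝ (Fin N) → ℝ}

theorem continuous_slice (hu : IsGlobalClassicalSolution N α p σ m w u) {t : ℝ} (ht : 0 ≤ t) :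
    Continuous (u t) := by
  rw [← continuousOn_univ]
  exact hu.1.comp (f := fun x => (t, x)) (by fun_prop) fun x _ => ⟨ht, mem_univ _⟩

theorem hasDerivAt_integral (hu : IsGlobalClassicalSolution N α p σ m w u) (hp : 0 ≤ p)
    (hw : Continuous w) {g : EuclideanSpace ℝ (Fin N) → ℝ} (hg : ContDiff ℝ 2 g)
    (hgc : HasCompactSupport g) (hgs : tsupport g ⊆ {x | x ≠ 0}) {t : ℝ} (ht : 1 ≤ t) :
    HasDerivAt (fun τ => ∫ x, u τ x * g x)
      ((∫ x, u t x * coordLaplacian g x) + (∫ x, ‖x‖ ^ α * |u t x| ^ p * g x)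
        + t ^ m * ∫ x, w x * g x) t := by
  have ht0 : 0 < t := by linarith
  have hopen : IsOpen {x : EuclideanSpace ℝ (Fin N) | x ≠ 0} := isOpen_ne
  have hderiv := hasDerivAt_integral_mul (μ := volume) hopen
    (fun τ hτ => (hu.continuous_slice (le_of_lt hτ)).continuousOn) hu.2.1 hu.2.2.1
    hg.continuous hgc hgs ht0
  have hut := hu.2.2.2.1 t ht0
  convert hderiv using 1
  have hFc : ContinuousOn (fun x => ‖x‖ ^ α * |u t x| ^ p) {x | x ≠ 0} := by
    refine (continuous_norm.continuousOn.rpow_const fun x hx =>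
      Or.inl (norm_ne_zero_iff.2 hx)).mul ?_
    exact ((hu.continuous_slice ht0.le).abs.rpow_const fun x => Or.inr hp).continuousOn
  have hLc : ContinuousOn (coordLaplacian (u t)) {x | x ≠ 0} :=
    continuousOn_finsetSum _ fun i _ => continuousOn_secondDirDeriv hopen hut _
  have i1 := hLc.integrable_mul_of_tsupport_subset (μ := volume) hopen hg.continuous hgc hgs
  have i2 := hFc.integrable_mul_of_tsupport_subset (μ := volume) hopen hg.continuous hgc hgs
  have i3 : Integrable (fun x => w x * g x) :=
    hw.continuousOn.integrable_mul_of_tsupport_subset isOpen_univ hg.continuous hgc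
      (subset_univ _)
  have i12 : Integrable (fun x => coordLaplacian (u t) x * g x + ‖x‖ ^ α * |u t x| ^ p * g x) :=
    i1.add i2
  rw [← integral_coordLaplacian_mul hopen hut hg hgc hgs, ← integral_add i1 i2,
    ← integral_const_mul, ← integral_add i12 (i3.const_mul _)]
  refine integral_congr_ae (Eventually.of_forall fun x => ?_)
  by_cases hx : x ∈ tsupport g
  · have heq := hu.2.2.2.2.1 t ht0 x (hgs hx)
    rw [zeta, if_neg (not_lt.2 ht)] at heq
    have hd : deriv (fun τ => u τ x) t
        = coordLaplacian (u t) x + ‖x‖ ^ α * |u t x| ^ p + t ^ m * w x := by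
      simp only [coordLaplacian, secondDirDeriv]
      linarith
    simp only [hd]
    ring
  · simp [image_eq_zero_of_notMem_tsupport hx]

theorem integrated_bound (hu : IsGlobalClassicalSolution N α p σ m w u) (hN : 2 ≤ N)
    (hp : 1 < p) (hm : m ≤ 0) (hw : Continuous w) {C₁ C₂ : ℝ}
    {ψ : EuclideanSpace ℝ (Fin N) → ℝ} (h : IsTestProfile p C₁ ψ) (hC₂ : 0 ≤ C₂)
    {η η' : ℝ → ℝ} (hη : ∀ s, HasDerivAt η (η' s) s) (h1 : η 1 = 0) (h2 : η 2 = 0)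
    (h01 : ∀ s ∈ Icc (1 : ℝ) 2, 0 ≤ η s ∧ η s ≤ 1)
    (hη' : ∀ s ∈ Icc (1 : ℝ) 2, |η' s| ≤ C₂ * η s ^ (1 / p))
    {R ε M : ℝ} (hR : 1 ≤ R) (hε : 0 < ε) (hε1 : ε ≤ 1) (hεR : 2 * ε ≤ R)
    (hM : ∀ t ∈ Icc (R ^ 2) (2 * R ^ 2), ∀ x, ‖x‖ ≤ 2 → |u t x| ≤ M)
    (hpos : 0 ≤ ∫ x, w x * annularCutoff ψ R ε x) :
    R ^ 2 * (2 * R ^ 2) ^ m * (∫ x, w x * annularCutoff ψ R ε x) * ∫ s in (1 : ℝ)..2, η s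
      ≤ ((C₁ + C₂) ^ (p / (p - 1)) * R ^ ((N : ℝ) - (α + 2) / (p - 1))
          * ∫ x : EuclideanSpace ℝ (Fin N) in Metric.ball 0 2, ‖x‖ ^ (-(α / (p - 1))))
        + R ^ 2 * M * ε ^ (N - 2) * ∫ x, |coordLaplacian ψ x| := by
  set Φ := annularCutoff ψ R ε with hΦ
  set A := (C₁ + C₂) ^ (p / (p - 1)) * R ^ ((N : ℝ) - (α + 2) / (p - 1))
      * ∫ x : EuclideanSpace ℝ (Fin N) in Metric.ball 0 2, ‖x‖ ^ (-(α / (p - 1))) with hA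
  set B := R ^ 2 * M * ε ^ (N - 2) * ∫ x, |coordLaplacian ψ x| with hB
  set W := ∫ x, w x * Φ x with hW
  have hR2 : 1 ≤ R ^ 2 := one_le_pow₀ hR
  have hηc : Continuous η := continuous_iff_continuousAt.2 fun s => (hη s).continuousAt
  have hderiv : ∀ s ∈ Icc (1 : ℝ) 2, HasDerivAt (fun s => (∫ x, u (R ^ 2 * s) x * Φ x) * η s)
      (((∫ x, u (R ^ 2 * s) x * coordLaplacian Φ x)
        + (∫ x, ‖x‖ ^ α * |u (R ^ 2 * s) x| ^ p * Φ x) + (R ^ 2 * s) ^ m * W) * (R ^ 2 * 1) * η s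
        + (∫ x, u (R ^ 2 * s) x * Φ x) * η' s) s := by
    intro s hs
    have ht : 1 ≤ R ^ 2 * s := by nlinarith [hs.1]
    have hI := hu.hasDerivAt_integral (by linarith) hw h.annularCutoff_contDiff
      (h.hasCompactSupport_annularCutoff hε hεR) (h.tsupport_annularCutoff_subset hε hεR) ht
    exact (HasDerivAt.comp s hI ((hasDerivAt_id s).const_mul (R ^ 2))).mul (hη s)
  have hmain := intervalIntegral.integral_le_sub_of_hasDeriv_right_of_le (a := 1) (b := 2)
    (g := fun s => (∫ x, u (R ^ 2 * s) x * Φ x) * η s)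
    (φ := fun s => R ^ 2 * (2 * R ^ 2) ^ m * W * η s - (A + B)) one_le_two
    (fun s hs => (hderiv s hs).continuousAt.continuousWithinAt)
    (fun s hs => (hderiv s (Ioo_subset_Icc_self hs)).hasDerivWithinAt)
    ((by fun_prop : Continuous fun s => R ^ 2 * (2 * R ^ 2) ^ m * W * η s - (A + B)).integrableOn_Icc)
    (by
      intro s hs
      have hs' := Ioo_subset_Icc_self hs
      obtain ⟨hη0, hη1⟩ := h01 s hs'
      have ht0 : 0 < R ^ 2 * s := by nlinarith [hs.1]
      have hsp := h.spatial_lower_bound hp hC₂ hN hu.2.2.2.2.2.2 hε hε1 hεR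
        (hu.continuous_slice ht0.le)
        (hM (R ^ 2 * s) ⟨by nlinarith [hs.1], by nlinarith [hs.2]⟩) hη0 hη1 (hη' s hs')
      have hpow : (2 * R ^ 2) ^ m ≤ (R ^ 2 * s) ^ m :=
        rpow_le_rpow_of_nonpos ht0 (by nlinarith [hs.2]) hm
      have hle : R ^ 2 * (2 * R ^ 2) ^ m * W * η s ≤ R ^ 2 * (R ^ 2 * s) ^ m * W * η s := by
        gcongr
      linarith)
  rw [h1, h2, intervalIntegral.integral_sub ((hηc.const_mul _).intervalIntegrable _ _)
    (continuous_const.intervalIntegrable _ _), intervalIntegral.integral_const_mul] at hmain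
  norm_num at hmain
  linarith

end IsGlobalClassicalSolution

theorem tendsto_integral_mul_comp_inv_smul_zero {N : ℕ} (hN : 1 ≤ N) {p C : ℝ}
    {ψ w : EuclideanSpace ℝ (Fin N) → ℝ} (h : IsTestProfile p C ψ) (hw : Integrable w) :
    Tendsto (fun ε : ℝ => ∫ x, w x * ψ (ε⁻¹ • x)) (𝓝[>] 0) (𝓝 0) := by
  have : Nonempty (Fin N) := ⟨⟨0, by omega⟩⟩
  suffices Tendsto (fun ε : ℝ => ∫ x, w x * ψ (ε⁻¹ • x)) (𝓝[>] 0)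
      (𝓝 (∫ _ : EuclideanSpace ℝ (Fin N), (0 : ℝ))) by simpa using this
  refine tendsto_integral_filter_of_dominated_convergence (fun x => |w x|) ?_ ?_ hw.abs ?_
  · refine Eventually.of_forall fun ε => ?_
    exact hw.aestronglyMeasurable.mul (h.contDiff_comp_smul _).continuous.aestronglyMeasurable
  · refine Eventually.of_forall fun ε => Eventually.of_forall fun x => ?_
    rw [norm_mul, Real.norm_of_nonneg (h.nonneg _)]
    exact mul_le_of_le_one_right (norm_nonneg _) (h.le_one _)
  · have hne : ∀ᵐ x : EuclideanSpace ℝ (Fin N), x ≠ 0 := by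
      simp [ae_iff, measure_singleton]
    filter_upwards [hne] with x hx
    refine tendsto_const_nhds.congr' ?_
    have hx2 : (0 : ℝ) < ‖x‖ / 2 := half_pos (norm_pos_iff.2 hx)
    filter_upwards [Ioo_mem_nhdsGT hx2] with ε hε
    rw [h.eq_zero, mul_zero]
    rw [le_norm_inv_smul_iff hε.1]
    linarith [hε.2]

theorem tendsto_integral_mul_comp_inv_smul_atTop {N : ℕ} {p C : ℝ}
    {ψ w : EuclideanSpace ℝ (Fin N) → ℝ} (h : IsTestProfile p C ψ) (hw : Integrable w) :
    Tendsto (fun R : ℝ => ∫ x, w x * ψ (R⁻¹ • x)) atTop (𝓝 (∫ x, w x)) := by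
  refine tendsto_integral_filter_of_dominated_convergence (fun x => |w x|) ?_ ?_ hw.abs ?_
  · refine Eventually.of_forall fun ε => ?_
    exact hw.aestronglyMeasurable.mul (h.contDiff_comp_smul _).continuous.aestronglyMeasurable
  · refine Eventually.of_forall fun ε => Eventually.of_forall fun x => ?_
    rw [norm_mul, Real.norm_of_nonneg (h.nonneg _)]
    exact mul_le_of_le_one_right (norm_nonneg _) (h.le_one _)
  · refine Eventually.of_forall fun x => ?_
    refine tendsto_const_nhds.congr' ?_
    filter_upwards [eventually_ge_atTop ‖x‖, eventually_gt_atTop 0] with R hR hR0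
    rw [h.eq_one, mul_one]
    rw [norm_inv_smul_le_iff hR0]
    linarith

/-- The rescaled test-function estimate, after the inner cutoff radius is sent to zero. -/
theorem IsGlobalClassicalSolution.outer_bound {N : ℕ} {α p σ m : ℝ}
    {w : EuclideanSpace ℝ (Fin N) → ℝ} {u : ℝ → EuclideanSpace ℝ (Fin N) → ℝ}
    (hu : IsGlobalClassicalSolution N α p σ m w u) (hN : 3 ≤ N)
    (hp : 1 < p) (hm : m ≤ 0) (hw : Continuous w) (hwi : Integrable w) {C₁ C₂ : ℝ}
    {ψ : EuclideanSpace ℝ (Fin N) → ℝ} (h : IsTestProfile p C₁ ψ) (hC₂ : 0 ≤ C₂)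
    {η η' : ℝ → ℝ} (hη : ∀ s, HasDerivAt η (η' s) s) (h1 : η 1 = 0) (h2 : η 2 = 0)
    (h01 : ∀ s ∈ Icc (1 : ℝ) 2, 0 ≤ η s ∧ η s ≤ 1)
    (hη' : ∀ s ∈ Icc (1 : ℝ) 2, |η' s| ≤ C₂ * η s ^ (1 / p))
    {R : ℝ} (hR : 1 ≤ R) (hpos : 0 < ∫ x, w x * ψ (R⁻¹ • x)) :
    R ^ 2 * (2 * R ^ 2) ^ m * (∫ x, w x * ψ (R⁻¹ • x)) * ∫ s in (1 : ℝ)..2, η s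
      ≤ (C₁ + C₂) ^ (p / (p - 1)) * R ^ ((N : ℝ) - (α + 2) / (p - 1))
          * ∫ x : EuclideanSpace ℝ (Fin N) in Metric.ball 0 2, ‖x‖ ^ (-(α / (p - 1))) := by
  have hK : IsCompact (Icc (R ^ 2) (2 * R ^ 2) ×ˢ
      Metric.closedBall (0 : EuclideanSpace ℝ (Fin N)) 2) :=
    isCompact_Icc.prod (isCompact_closedBall 0 2)
  obtain ⟨M, hM⟩ := hK.exists_bound_of_continuousOn (hu.1.mono fun q hq =>
    ⟨(sq_nonneg R).trans hq.1.1, mem_univ _⟩)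
  have hint : ∀ c : ℝ, Integrable (fun x => w x * ψ (c • x)) := fun c =>
    hwi.mono (hwi.aestronglyMeasurable.mul
      (h.contDiff_comp_smul c).continuous.aestronglyMeasurable) (Eventually.of_forall fun x => by
        rw [norm_mul, Real.norm_of_nonneg (h.nonneg _)]
        exact mul_le_of_le_one_right (norm_nonneg _) (h.le_one _))
  have hlim : Tendsto (fun ε : ℝ => ∫ x, w x * annularCutoff ψ R ε x) (𝓝[>] 0)
      (𝓝 (∫ x, w x * ψ (R⁻¹ • x))) := by
    have := (tendsto_integral_mul_comp_inv_smul_zero (by omega) h hwi).const_sub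
      (∫ x, w x * ψ (R⁻¹ • x))
    rw [sub_zero] at this
    refine this.congr fun ε => ?_
    rw [← integral_sub (hint _) (hint _)]
    simp only [annularCutoff, mul_sub]
  have hright : Tendsto (fun ε : ℝ =>
      (C₁ + C₂) ^ (p / (p - 1)) * R ^ ((N : ℝ) - (α + 2) / (p - 1))
          * (∫ x : EuclideanSpace ℝ (Fin N) in Metric.ball 0 2, ‖x‖ ^ (-(α / (p - 1))))
        + R ^ 2 * M * ε ^ (N - 2) * ∫ x, |coordLaplacian ψ x|) (𝓝[>] 0)
      (𝓝 ((C₁ + C₂) ^ (p / (p - 1)) * R ^ ((N : ℝ) - (α + 2) / (p - 1))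
          * ∫ x : EuclideanSpace ℝ (Fin N) in Metric.ball 0 2, ‖x‖ ^ (-(α / (p - 1))))) := by
    refine Tendsto.mono_left ?_ nhdsWithin_le_nhds
    refine (Continuous.tendsto (by fun_prop) 0).trans_eq ?_
    rw [zero_pow (by omega)]
    ring_nf
  refine le_of_tendsto_of_tendsto ((hlim.const_mul (R ^ 2 * (2 * R ^ 2) ^ m)).mul_const _)
    hright ?_
  filter_upwards [hlim.eventually_const_lt hpos,
    Ioo_mem_nhdsGT (by norm_num : (0 : ℝ) < 1 / 2)] with ε hε hε2
  exact hu.integrated_bound (by omega) hp hm hw h hC₂ hη h1 h2 h01 hη' hR hε2.1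
    (by linarith [hε2.2]) (by linarith [hε2.2])
    (fun t ht x hx => hM (t, x) ⟨ht, by simpa using hx⟩) hε.le

/-- Blow-up for `N ≥ 3`, `m ≤ 0` and `1 < p < (N - 2m + α)/(N - 2m - 2)`:
if `∫ w > 0` then there is no global classical solution. -/
theorem stmt_10 (N : ℕ) (hN : 3 ≤ N) (α m p σ : ℝ) (hα : -2 < α) (hm : m ≤ 0)
    (hp1 : 1 < p) (hp2 : p < ((N : ℝ) - 2 * m + α) / ((N : ℝ) - 2 * m - 2))
    (hσ : -1 < σ)
    (w : EuclideanSpace ℝ (Fin N) → ℝ) (hwc : Continuous w)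
    (hw0 : Tendsto w (cocompact _) (nhds 0))
    (hwi : Integrable w) (hwpos : 0 < ∫ x, w x) :
    ¬ ∃ u : ℝ → EuclideanSpace ℝ (Fin N) → ℝ,
        IsGlobalClassicalSolution N α p σ m w u := by
  rintro ⟨u, hu⟩
  obtain ⟨C₁, ψ, hψ⟩ := exists_isTestProfile N hp1
  obtain ⟨C₂, η, η', hC₂, hη, -, h1, h2, h01, hη', hηpos⟩ := exists_time_profile hp1
  set c := ∫ s in (1 : ℝ)..2, η s
  set K := (C₁ + C₂) ^ (p / (p - 1))
      * ∫ x : EuclideanSpace ℝ (Fin N) in Metric.ball 0 2, ‖x‖ ^ (-(α / (p - 1)))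
  have hN' : (3 : ℝ) ≤ N := by exact_mod_cast hN
  have hp0 : 0 < p - 1 := by linarith
  have hexp : 0 < 2 + 2 * m - ((N : ℝ) - (α + 2) / (p - 1)) := by
    rw [lt_div_iff₀ (by linarith)] at hp2
    have : (N : ℝ) - 2 - 2 * m < (α + 2) / (p - 1) := by
      rw [lt_div_iff₀ hp0]
      linarith
    linarith
  have hlim := tendsto_integral_mul_comp_inv_smul_atTop hψ hwi
  have hbound : ∀ᶠ R : ℝ in atTop, 2 ^ m * (∫ x, w x * ψ (R⁻¹ • x)) * c
      ≤ K * R ^ (-(2 + 2 * m - ((N : ℝ) - (α + 2) / (p - 1)))) := by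
    filter_upwards [hlim.eventually_const_lt hwpos, eventually_ge_atTop 1] with R hR hR1
    have hR0 : 0 < R := by linarith
    have hle := hu.outer_bound hN hp1 hm hwc hwi hψ hC₂ hη h1 h2 h01 hη' hR1 hR
    have e1 : R ^ 2 * (2 * R ^ 2) ^ m = 2 ^ m * R ^ (2 + 2 * m) := by
      rw [mul_rpow (by norm_num) (by positivity), rpow_add hR0, ← rpow_natCast R 2,
        ← rpow_mul hR0.le]
      push_cast
      ring
    have e2 : R ^ ((N : ℝ) - (α + 2) / (p - 1))
        = R ^ (-(2 + 2 * m - ((N : ℝ) - (α + 2) / (p - 1)))) * R ^ (2 + 2 * m) := by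
      rw [← rpow_add hR0]
      congr 1
      ring
    rw [e1, e2] at hle
    refine le_of_mul_le_mul_right ?_ (rpow_pos_of_pos hR0 (2 + 2 * m))
    linarith
  have hcontra := le_of_tendsto_of_tendsto ((hlim.const_mul (2 ^ m)).mul_const c)
    ((tendsto_rpow_neg_atTop hexp).const_mul K) hbound
  have : 0 < 2 ^ m * (∫ x, w x) * c := by positivity
  linarith
end
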